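/- arXiv:1302.3303 — 7 statements merged into one kernel-verified Lean document; each statement's English description precedes it below -/
import Mathlib

section
/- Let n = 2, U ⊆ ℝ² open, and let α, β, D be as in the singular (α,β)-metric setup. Assume ‖β‖_α ≡ b on U for a positive constant b, and that β is not parallel with respect to α. Let m > 0 and k be real constants with m ≠ 1 and 1 − k·t² > 0 for all t ∈ [0, b), and define φ : (0, b) → ℝ by φ(s) := m·b²·√(b² − s²)·∫₀ˢ (b² − t²)^{−3/2}·(t/√(1 − k·t²))^{m−1} dt, and F(x,y) := α·φ(β/α) on D, assumed positive on D. Suppose moreover that on U: r_{ij} = −(b_i s_j + b_j s_i)/b², and there is a smooth 1-form ρ = ρ_i(x) y^i such that G^i_α = ρ·y^i − (((m−2)·α² + k·β²)/((m−1)·b²))·s^i, where s^i := Σ_j a^{ij} s_j. If F is projectively flat on U with constant flag curvature K, then one of the following holds: (i) φ(s) = s^m·(1 − s²/b²)^{(1−m)/2} for all s ∈ (0,b), and K = 0; (ii) k·b² ≠ 1 and φ(s) = (2b/(1 − k·b²))·(b·√(1 − k·s²) − √(b² − s²)) for all s ∈ (0,b); (iii) k·b² ≠ 1 and φ(s) =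 (4b²/(1 − k·b²)²)·(b·√(1 − k·s²) − √(b² − s²))²/√(1 − k·s²) for all s ∈ (0,b), and K = 0. -/
noncomputable section

open Real Finset

/-- Partial derivative of `f` at `x` in the `k`-th coordinate direction. -/
def pd {n : ℕ} (f : (Fin n → ℝ) → ℝ) (x : Fin n → ℝ) (k : Fin n) : ℝ :=
  fderiv ℝ f x (Pi.single k 1)

/-- `α(x,y) = √(Σ_{i,j} a_{ij}(x) yⁱ yʲ)`. -/
def alphaFn {n : ℕ} (a : (Fin n → ℝ) → Matrix (Fin n) (Fin n) ℝ) (x y : Fin n → ℝ) : ℝ :=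
  Real.sqrt (∑ i, ∑ j, a x i j * y i * y j)

/-- `β(x,y) = Σ_i b_i(x) yⁱ`. -/
def betaFn {n : ℕ} (b : (Fin n → ℝ) → Fin n → ℝ) (x y : Fin n → ℝ) : ℝ :=
  ∑ i, b x i * y i

/-- `‖β‖_α(x) = √(Σ_{i,j} aⁱʲ(x) b_i(x) b_j(x))`. -/
def normBeta {n : ℕ} (a : (Fin n → ℝ) → Matrix (Fin n) (Fin n) ℝ)
    (b : (Fin n → ℝ) → Fin n → ℝ) (x : Fin n → ℝ) : ℝ :=
  Real.sqrt (∑ i, ∑ j, (a x)⁻¹ i j * b x i * b x j)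

/-- `D = {(x,y) : x ∈ U, y ≠ 0, β(x,y) > 0}`. -/
def Dom {n : ℕ} (U : Set (Fin n → ℝ)) (b : (Fin n → ℝ) → Fin n → ℝ) :
    Set ((Fin n → ℝ) × (Fin n → ℝ)) :=
  {p | p.1 ∈ U ∧ p.2 ≠ 0 ∧ 0 < betaFn b p.1 p.2}

/-- Hamel's equations: `Σ_k yᵏ ∂²F/∂xᵏ∂yˡ = ∂F/∂xˡ` on `D`, for every `l`. -/
def HamelProjFlat {n : ℕ} (U : Set (Fin n → ℝ)) (b : (Fin n → ℝ) → Fin n → ℝ)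
    (F : (Fin n → ℝ) → (Fin n → ℝ) → ℝ) : Prop :=
  ∀ p ∈ Dom U b, ∀ l : Fin n,
    ∑ k, p.2 k * pd (fun y' => pd (fun x' => F x' y') p.1 k) p.2 l
      = pd (fun x' => F x' p.2) p.1 l

/-- The projective factor `P = (Σ_k yᵏ ∂F/∂xᵏ)/(2F)`. -/
def projFactor {n : ℕ} (F : (Fin n → ℝ) → (Fin n → ℝ) → ℝ) (x y : Fin n → ℝ) : ℝ :=
  (∑ k, y k * pd (fun x' => F x' y) x k) / (2 * F x y)

/-- Constant flag curvature `K`: `P² − Σ_k yᵏ ∂P/∂xᵏ = K·F²` on `D`. -/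
def ConstFlagCurv {n : ℕ} (U : Set (Fin n → ℝ)) (b : (Fin n → ℝ) → Fin n → ℝ)
    (F : (Fin n → ℝ) → (Fin n → ℝ) → ℝ) (K : ℝ) : Prop :=
  ∀ p ∈ Dom U b,
    (projFactor F p.1 p.2) ^ 2
      - ∑ k, p.2 k * pd (fun x' => projFactor F x' p.2) p.1 k
      = K * (F p.1 p.2) ^ 2

/-- Christoffel symbols `Γˡ_{jk}` of the Riemannian metric `a`. -/
def christoffel {n : ℕ} (a : (Fin n → ℝ) → Matrix (Fin n) (Fin n) ℝ)
    (x : Fin n → ℝ) (l j k : Fin n) : ℝ :=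
  (1 / 2) * ∑ i, (a x)⁻¹ l i *
    (pd (fun x' => a x' j i) x k + pd (fun x' => a x' k i) x j
      - pd (fun x' => a x' j k) x i)

/-- Covariant derivative `b_{i|j}` of the 1-form `b` with respect to `a`. -/
def covDeriv {n : ℕ} (a : (Fin n → ℝ) → Matrix (Fin n) (Fin n) ℝ)
    (b : (Fin n → ℝ) → Fin n → ℝ) (x : Fin n → ℝ) (i j : Fin n) : ℝ :=
  pd (fun x' => b x' i) x j - ∑ l, b x l * christoffel a x l i j

/-- Spray coefficients `Gⁱ_α = ½ Σ_{j,k} Γⁱ_{jk} yʲ yᵏ` of `α`. -/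
def spray {n : ℕ} (a : (Fin n → ℝ) → Matrix (Fin n) (Fin n) ℝ)
    (x y : Fin n → ℝ) (i : Fin n) : ℝ :=
  (1 / 2) * ∑ j, ∑ k, christoffel a x i j k * y j * y k

/-- `r_{ij} = ½(b_{i|j} + b_{j|i})`. -/
def rTensor {n : ℕ} (a : (Fin n → ℝ) → Matrix (Fin n) (Fin n) ℝ)
    (b : (Fin n → ℝ) → Fin n → ℝ) (x : Fin n → ℝ) (i j : Fin n) : ℝ :=
  (covDeriv a b x i j + covDeriv a b x j i) / 2

/-- `s_{ij} = ½(b_{i|j} − b_{j|i})`. -/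
def sTensor {n : ℕ} (a : (Fin n → ℝ) → Matrix (Fin n) (Fin n) ℝ)
    (b : (Fin n → ℝ) → Fin n → ℝ) (x : Fin n → ℝ) (i j : Fin n) : ℝ :=
  (covDeriv a b x i j - covDeriv a b x j i) / 2

/-- `bⁱ = Σ_j aⁱʲ b_j`. -/
def bUp {n : ℕ} (a : (Fin n → ℝ) → Matrix (Fin n) (Fin n) ℝ)
    (b : (Fin n → ℝ) → Fin n → ℝ) (x : Fin n → ℝ) (i : Fin n) : ℝ :=
  ∑ j, (a x)⁻¹ i j * b x j

/-- `s_j = Σ_i bⁱ s_{ij}`. -/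
def sLow {n : ℕ} (a : (Fin n → ℝ) → Matrix (Fin n) (Fin n) ℝ)
    (b : (Fin n → ℝ) → Fin n → ℝ) (x : Fin n → ℝ) (j : Fin n) : ℝ :=
  ∑ i, bUp a b x i * sTensor a b x i j

/-- `sⁱ = Σ_j aⁱʲ s_j`. -/
def sUp {n : ℕ} (a : (Fin n → ℝ) → Matrix (Fin n) (Fin n) ℝ)
    (b : (Fin n → ℝ) → Fin n → ℝ) (x : Fin n → ℝ) (i : Fin n) : ℝ :=
  ∑ j, (a x)⁻¹ i j * sLow a b x j

open Filter Topology

/-- A solution of `x f' = g - A f` with `A → a > 1` and `x f → 0` at `0⁺` tends to `g(0)/a`. -/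
lemma tendsto_of_fuchsian {f f' A g : ℝ → ℝ} {a g₀ : ℝ} (ha : 1 < a)
    (hf : ∀ᶠ x in 𝓝[>] (0 : ℝ), HasDerivAt f (f' x) x ∧ x * f' x = g x - A x * f x)
    (hA : Tendsto A (𝓝[>] 0) (𝓝 a)) (hg : Tendsto g (𝓝[>] 0) (𝓝 g₀))
    (hxf : Tendsto (fun x => x * f x) (𝓝[>] 0) (𝓝 0)) :
    Tendsto f (𝓝[>] 0) (𝓝 (g₀ / a)) := by
  have ha0 : a ≠ 0 := by positivity
  set L := g₀ / a with hL
  have hG : Tendsto (fun x => g x - A x * L) (𝓝[>] 0) (𝓝 0) := by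
    have := hg.sub (hA.mul_const L)
    rwa [hL, mul_div_cancel₀ _ ha0, sub_self] at this
  rw [Metric.tendsto_nhds]
  intro ε hε
  set d := (a - 1) / 2 with hd
  have hd0 : 0 < d := by rw [hd]; linarith
  have hG2 : ∀ᶠ x in 𝓝[>] (0 : ℝ), (g x - A x * L) ^ 2 < d * ε ^ 2 := by
    have h2 := hG.pow 2
    have : (0 : ℝ) ^ 2 < d * ε ^ 2 := by
      rw [zero_pow two_ne_zero]; positivity
    exact h2.eventually_lt_const this
  have hA2 : ∀ᶠ x in 𝓝[>] (0 : ℝ), 1 + d < A x :=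
    hA.eventually_const_lt (by rw [hd]; linarith)
  obtain ⟨r, hr, hall⟩ := mem_nhdsGT_iff_exists_Ioo_subset.1 (hf.and (hG2.and hA2))
  have hr0 : 0 < r := hr
  set E : ℝ → ℝ := fun x => x ^ 2 * ((f x - L) ^ 2 - (ε / 2) ^ 2) with hE
  have hEd : ∀ x ∈ Set.Ioo 0 r, HasDerivAt E
      (2 * x * ((f x - L) ^ 2 - (ε / 2) ^ 2) + x ^ 2 * (2 * (f x - L) * f' x)) x := by
    intro x hx
    obtain ⟨⟨h1, -⟩, -⟩ := hall hx
    have := ((hasDerivAt_id x).pow 2).mul (((h1.sub_const L).pow 2).sub_const ((ε / 2) ^ 2))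
    refine this.congr_deriv ?_
    simp
  have hanti : AntitoneOn E (Set.Ioo 0 r) := by
    apply antitoneOn_of_deriv_nonpos (convex_Ioo 0 r)
    · exact fun x hx => (hEd x hx).continuousAt.continuousWithinAt
    · rw [interior_Ioo]
      exact fun x hx => (hEd x hx).differentiableAt.differentiableWithinAt
    · rw [interior_Ioo]
      intro x hx
      rw [(hEd x hx).deriv]
      obtain ⟨⟨-, h1⟩, h2, h3⟩ := hall hx
      have hx0 : 0 < x := hx.1
      set v := f x - L
      set q := g x - A x * L
      have e1 : x * f' x = q - A x * v := by rw [h1]; simp only [q, v]; ring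
      have : 2 * x * (v ^ 2 - (ε / 2) ^ 2) + x ^ 2 * (2 * v * f' x)
          = 2 * x * (v ^ 2 - (ε / 2) ^ 2 + v * (q - A x * v)) := by rw [← e1]; ring
      rw [this]
      apply mul_nonpos_of_nonneg_of_nonpos (by positivity)
      have k1 : d * (v * q) ≤ d * (d * v ^ 2 + (ε / 2) ^ 2) := by
        nlinarith [sq_nonneg (2 * d * v - q), sq_nonneg q]
      have k2 := le_of_mul_le_mul_left k1 hd0
      nlinarith [mul_nonneg (sub_nonneg.2 h3.le) (sq_nonneg v)]
  have hE0 : Tendsto E (𝓝[>] 0) (𝓝 0) := by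
    have hx0 : Tendsto (fun x : ℝ => x) (𝓝[>] 0) (𝓝 0) := tendsto_nhdsWithin_of_tendsto_nhds tendsto_id
    have h1 := ((hxf.sub (hx0.mul_const L)).pow 2).sub ((hx0.pow 2).mul_const ((ε / 2) ^ 2))
    have h2 : ((0 - 0 * L) ^ 2 - 0 ^ 2 * (ε / 2) ^ 2 : ℝ) = 0 := by ring
    rw [h2] at h1
    refine h1.congr fun x => ?_
    simp only [hE]; ring
  refine mem_nhdsGT_iff_exists_Ioo_subset.2 ⟨r, hr, fun x hx => ?_⟩
  have hle : E x ≤ 0 := by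
    refine ge_of_tendsto hE0 ?_
    filter_upwards [Ioo_mem_nhdsGT hx.1] with t ht
    exact hanti ⟨ht.1, ht.2.trans hx.2⟩ hx ht.2.le
  have hx2 : 0 < x ^ 2 := by have : 0 < x := hx.1; positivity
  have h3 : (f x - L) ^ 2 ≤ (ε / 2) ^ 2 := by
    by_contra hcon
    push Not at hcon
    have : 0 < E x := mul_pos hx2 (sub_pos.2 hcon)
    linarith
  have := abs_le_of_sq_le_sq h3 (by positivity)
  show dist (f x) L < ε
  rw [Real.dist_eq]
  linarith

lemma eq_of_fuchsian_of_tendsto {f f' A g : ℝ → ℝ} {a g₀ L : ℝ}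
    (hf : ∀ᶠ x in 𝓝[>] (0 : ℝ), HasDerivAt f (f' x) x ∧ x * f' x = g x - A x * f x)
    (hA : Tendsto A (𝓝[>] 0) (𝓝 a)) (hg : Tendsto g (𝓝[>] 0) (𝓝 g₀))
    (hL : Tendsto f (𝓝[>] 0) (𝓝 L)) : a * L = g₀ := by
  have hx0 : Tendsto (fun x : ℝ => x) (𝓝[>] 0) (𝓝 0) := tendsto_nhdsWithin_of_tendsto_nhds tendsto_id
  have h1 : Tendsto (fun x => x * f x) (𝓝[>] 0) (𝓝 0) := by simpa using hx0.mul hL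
  have h2 : Tendsto (fun x => x * f x / x) (𝓝[>] 0) (𝓝 (L + (g₀ - a * L))) := by
    refine HasDerivAt.lhopital_zero_nhdsGT (f' := fun x => 1 * f x + x * f' x) (g' := fun _ => 1)
      (hf.mono fun x hx => (hasDerivAt_id x).mul hx.1) (Eventually.of_forall fun x => hasDerivAt_id x)
      (Eventually.of_forall fun x => one_ne_zero) h1 hx0 ?_
    refine (hL.add (hg.sub (hA.mul hL))).congr' ?_
    filter_upwards [hf] with x hx
    rw [hx.2.symm]; simp
  have h3 : Tendsto (fun x => x * f x / x) (𝓝[>] 0) (𝓝 L) := by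
    refine hL.congr' ?_
    filter_upwards [self_mem_nhdsWithin] with x hx
    have : x ≠ 0 := ne_of_gt hx
    field_simp
  have := tendsto_nhds_unique h2 h3
  linarith

lemma tendsto_id_nhdsGT_zero : Tendsto (fun x : ℝ => x) (𝓝[>] 0) (𝓝 0) :=
  tendsto_nhdsWithin_of_tendsto_nhds tendsto_id

/-- `f` solves `2x(1+x) f' = a + b f - M x^j f²` near `0⁺`. -/
def RiccatiNear (f a b : ℝ → ℝ) (M : ℝ) (j : ℕ) : Prop :=
  ∃ f' : ℝ → ℝ, ∀ᶠ x in 𝓝[>] (0 : ℝ), HasDerivAt f (f' x) x ∧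
    2 * x * (1 + x) * f' x = a x + b x * f x - M * x ^ j * f x ^ 2

lemma RiccatiNear.of_exists {f a b : ℝ → ℝ} {M : ℝ} {j : ℕ}
    (h : ∀ x, 0 < x → ∃ d, HasDerivAt f d x ∧
      2 * x * (1 + x) * d = a x + b x * f x - M * x ^ j * f x ^ 2) : RiccatiNear f a b M j := by
  refine ⟨deriv f, ?_⟩
  filter_upwards [self_mem_nhdsWithin] with x hx
  obtain ⟨d, hd, he⟩ := h x hx
  rw [hd.deriv]
  exact ⟨hd, he⟩

lemma RiccatiNear.tendsto {f a b : ℝ → ℝ} {M a₀ b₀ : ℝ} {j : ℕ}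
    (h : RiccatiNear f a b M (j + 1)) (hb₀ : 2 < b₀)
    (ha : Tendsto a (𝓝[>] 0) (𝓝 a₀)) (hb : Tendsto b (𝓝[>] 0) (𝓝 (-b₀)))
    (hxf : Tendsto (fun x => x * f x) (𝓝[>] 0) (𝓝 0)) :
    Tendsto f (𝓝[>] 0) (𝓝 (a₀ / b₀)) := by
  obtain ⟨f', hf⟩ := h
  have hx := tendsto_id_nhdsGT_zero
  have hden : Tendsto (fun x : ℝ => 2 * (1 + x)) (𝓝[>] 0) (𝓝 2) := by
    simpa using (hx.const_add 1).const_mul 2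
  have key := tendsto_of_fuchsian (f := f) (f' := f') (a := b₀ / 2) (g₀ := a₀ / 2)
    (A := fun x => (-b x + M * x ^ j * (x * f x)) / (2 * (1 + x)))
    (g := fun x => a x / (2 * (1 + x))) (by linarith) ?_ ?_ (ha.div hden two_ne_zero) hxf
  · convert key using 2
    have : b₀ ≠ 0 := by positivity
    field_simp
  · filter_upwards [hf, self_mem_nhdsWithin] with x hx hpos
    have : 0 < x := hpos
    refine ⟨hx.1, ?_⟩
    field_simp
    linear_combination hx.2
  · have := (hb.neg.add (((hx.pow j).const_mul M).mul hxf)).div hden two_ne_zero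
    rw [mul_zero, add_zero, neg_neg] at this
    exact this

lemma RiccatiNear.divX {f a b a₂ b₂ : ℝ → ℝ} {M c : ℝ} {j : ℕ} (h : RiccatiNear f a b M j)
    (ha : ∀ x, a x + b x * c - M * x ^ j * c ^ 2 = x * a₂ x)
    (hb : ∀ x, b x - 2 * M * x ^ j * c - 2 * (1 + x) = b₂ x) :
    RiccatiNear (fun x => (f x - c) / x) a₂ b₂ M (j + 1) := by
  obtain ⟨f', hf⟩ := h
  refine ⟨fun x => (f' x - (f x - c) / x) / x, ?_⟩
  filter_upwards [hf, self_mem_nhdsWithin] with x hx hpos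
  have hx0 : x ≠ 0 := ne_of_gt hpos
  constructor
  · refine ((hx.1.sub_const c).div (hasDerivAt_id x) hx0).congr_deriv ?_
    simp only [id]
    field_simp
  · have e1 := hx.2
    have e2 := ha x
    obtain ⟨g, hg⟩ : ∃ g, f x = c + x * g := ⟨(f x - c) / x, by field_simp; ring⟩
    have hg' : (f x - c) / x = g := by rw [hg]; field_simp; ring
    simp only [hg', ← hb]
    rw [hg] at e1
    apply mul_left_cancel₀ hx0
    have : x * (2 * x * (1 + x) * ((f' x - g) / x)) = 2 * x * (1 + x) * (f' x - g) := by
      field_simp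
    rw [this, pow_succ]
    linear_combination e1 + e2

lemma tendsto_mul_div_sub {f : ℝ → ℝ} {c : ℝ} (h : Tendsto f (𝓝[>] 0) (𝓝 c)) :
    Tendsto (fun x => x * ((f x - c) / x)) (𝓝[>] 0) (𝓝 0) := by
  have h1 := h.sub_const c
  rw [sub_self] at h1
  refine h1.congr' ?_
  filter_upwards [self_mem_nhdsWithin] with x hpos
  have hx0 : x ≠ 0 := ne_of_gt hpos
  field_simp

/-- One step of the power series expansion of a solution of a Riccati equation. -/
lemma RiccatiNear.step {f a b a₂ b₂ : ℝ → ℝ} {M c b₀ : ℝ} {j : ℕ} (h : RiccatiNear f a b M j)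
    (hc : Tendsto f (𝓝[>] 0) (𝓝 c))
    (ha : ∀ x, a x + b x * c - M * x ^ j * c ^ 2 = x * a₂ x)
    (hb : ∀ x, b x - 2 * M * x ^ j * c - 2 * (1 + x) = b₂ x)
    (ha₂ : Continuous a₂) (hb₂ : Continuous b₂) (hb₀ : 2 < b₀) (hb₂0 : b₂ 0 = -b₀) :
    ∃ g : ℝ → ℝ, RiccatiNear g a₂ b₂ M (j + 1) ∧ Tendsto g (𝓝[>] 0) (𝓝 (a₂ 0 / b₀)) ∧
      ∀ᶠ x in 𝓝[>] (0 : ℝ), f x = c + x * g x := by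
  refine ⟨_, h.divX ha hb, (h.divX ha hb).tendsto hb₀ ?_ ?_ (tendsto_mul_div_sub hc), ?_⟩
  · exact tendsto_nhdsWithin_of_tendsto_nhds (ha₂.tendsto 0)
  · rw [← hb₂0]; exact tendsto_nhdsWithin_of_tendsto_nhds (hb₂.tendsto 0)
  · filter_upwards [self_mem_nhdsWithin] with x hpos
    have hx0 : x ≠ 0 := ne_of_gt hpos
    field_simp
    ring

lemma RiccatiNear.linear_limit {f a b : ℝ → ℝ} {a₀ b₀ L : ℝ} {j : ℕ} (h : RiccatiNear f a b 0 j)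
    (ha : Tendsto a (𝓝[>] 0) (𝓝 a₀)) (hb : Tendsto b (𝓝[>] 0) (𝓝 b₀))
    (hL : Tendsto f (𝓝[>] 0) (𝓝 L)) : a₀ + b₀ * L = 0 := by
  obtain ⟨f', hf⟩ := h
  have hden : Tendsto (fun x : ℝ => 2 * (1 + x)) (𝓝[>] 0) (𝓝 2) := by
    simpa using (tendsto_id_nhdsGT_zero.const_add 1).const_mul 2
  have := eq_of_fuchsian_of_tendsto (f := f) (f' := f') (a := -b₀ / 2) (g₀ := a₀ / 2)
    (A := fun x => -b x / (2 * (1 + x))) (g := fun x => a x / (2 * (1 + x))) ?_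
    (hb.neg.div hden two_ne_zero) (ha.div hden two_ne_zero) hL
  · linarith
  · filter_upwards [hf, self_mem_nhdsWithin] with x hx hpos
    have : 0 < x := hpos
    refine ⟨hx.1, ?_⟩
    field_simp
    linear_combination hx.2

/-- Subtracting the leading coefficient and dividing by `x` preserves linear equations. -/
lemma RiccatiNear.linear_step {f a b q a₂ : ℝ → ℝ} {c : ℝ} (h : RiccatiNear f a b 0 0)
    (hfq : ∀ᶠ x in 𝓝[>] (0 : ℝ), f x = c + x * q x)
    (ha₂ : ∀ᶠ x in 𝓝[>] (0 : ℝ), a x + b x * c = x * a₂ x) :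
    RiccatiNear q a₂ (fun x => b x - 2 * (1 + x)) 0 0 := by
  obtain ⟨f', hf⟩ := h
  refine ⟨fun x => (f' x - q x) / x, ?_⟩
  have hfq' : ∀ᶠ x in 𝓝[>] (0 : ℝ), ∀ᶠ y in 𝓝 x, q y = (f y - c) / y := by
    have h1 : ∀ᶠ x in 𝓝[>] (0 : ℝ), q x = (f x - c) / x := by
      filter_upwards [hfq, self_mem_nhdsWithin] with x hx hpos
      have hx0 : x ≠ 0 := ne_of_gt hpos
      rw [hx]; field_simp; ring
    exact eventually_eventually_nhdsWithin.2 h1 |>.and self_mem_nhdsWithin |>.mono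
      fun x hx => by
        have := hx.1
        rwa [IsOpen.nhdsWithin_eq isOpen_Ioi hx.2] at this
  filter_upwards [hf, hfq', self_mem_nhdsWithin, ha₂] with x hx hq hpos ha
  have hx0 : x ≠ 0 := ne_of_gt hpos
  have hqx := hq.self_of_nhds
  constructor
  · refine (((hx.1.sub_const c).div (hasDerivAt_id x) hx0).congr_of_eventuallyEq hq).congr_deriv ?_
    simp only [id, hqx]
    field_simp
  · have e1 := hx.2
    obtain ⟨g, hg⟩ : ∃ g, f x = c + x * g := ⟨(f x - c) / x, by field_simp; ring⟩
    have hg' : q x = g := by rw [hqx, hg]; field_simp; ring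
    simp only [hg']
    rw [hg] at e1
    apply mul_left_cancel₀ hx0
    have : x * (2 * x * (1 + x) * ((f' x - g) / x)) = 2 * x * (1 + x) * (f' x - g) := by
      field_simp
    rw [this]
    linear_combination e1 + ha

/-- The Taylor expansion to order five at `0` of the solution with `Z(0) = 1` of
`2x(1+x) Z' = (1+x)(Z+1) + (m-3) Z - (m-1) Z²`. -/
lemma riccati_expansion {m : ℝ} (hm : 0 < m) {Z : ℝ → ℝ}
    (hZ : RiccatiNear Z (fun x => 1 + x) (fun x => x + m - 2) (m - 1) 0)
    (hZ1 : Tendsto Z (𝓝[>] 0) (𝓝 1)) {M z₁ z₂ z₃ z₄ z₅ : ℝ} (hM : m = M + 1)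
    (h₁ : z₁ * (m + 2) = 2) (h₂ : z₂ * (m + 4) = -z₁ - M * z₁ ^ 2)
    (h₃ : z₃ * (m + 6) = -(3 + 2 * M * z₁) * z₂)
    (h₄ : z₄ * (m + 8) = -M * z₂ ^ 2 - (5 + 2 * M * z₁) * z₃)
    (h₅ : z₅ * (m + 10) = -2 * M * z₂ * z₃ - (7 + 2 * M * z₁) * z₄) :
    ∃ g₁ g₂ g₃ g₄ g₅ : ℝ → ℝ,
      (∀ᶠ x in 𝓝[>] (0 : ℝ), Z x = 1 + x * g₁ x) ∧
      (∀ᶠ x in 𝓝[>] (0 : ℝ), g₁ x = z₁ + x * g₂ x) ∧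
      (∀ᶠ x in 𝓝[>] (0 : ℝ), g₂ x = z₂ + x * g₃ x) ∧
      (∀ᶠ x in 𝓝[>] (0 : ℝ), g₃ x = z₃ + x * g₄ x) ∧
      (∀ᶠ x in 𝓝[>] (0 : ℝ), g₄ x = z₄ + x * g₅ x) ∧
      Tendsto g₁ (𝓝[>] 0) (𝓝 z₁) ∧ Tendsto g₂ (𝓝[>] 0) (𝓝 z₂) ∧
      Tendsto g₃ (𝓝[>] 0) (𝓝 z₃) ∧ Tendsto g₄ (𝓝[>] 0) (𝓝 z₄) ∧
      Tendsto g₅ (𝓝[>] 0) (𝓝 z₅) := by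
  have hM' : m - 1 = M := by linarith
  obtain ⟨g₁, k₁, l₁, d₁⟩ := hZ.step (c := 1) (a₂ := fun _ => 2)
    (b₂ := fun x => -(m + 2) - x) (b₀ := m + 2) hZ1
    (fun x => by ring) (fun x => by ring) (by fun_prop) (by fun_prop) (by linarith) (by ring)
  have r₁ : (2 : ℝ) / (m + 2) = z₁ := by
    rw [div_eq_iff (by positivity), h₁]
  rw [r₁] at l₁
  obtain ⟨g₂, k₂, l₂, d₂⟩ := k₁.step (c := z₁) (a₂ := fun _ => -z₁ - M * z₁ ^ 2)
    (b₂ := fun x => -(m + 4) - x * (3 + 2 * M * z₁)) (b₀ := m + 4) l₁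
    (fun x => by rw [hM']; linear_combination -h₁) (fun x => by rw [hM']; ring)
    (by fun_prop) (by fun_prop) (by linarith) (by ring)
  have r₂ : (-z₁ - M * z₁ ^ 2) / (m + 4) = z₂ := by
    rw [div_eq_iff (by positivity), h₂]
  rw [r₂] at l₂
  obtain ⟨g₃, k₃, l₃, d₃⟩ := k₂.step (c := z₂)
    (a₂ := fun x => -(3 + 2 * M * z₁) * z₂ - M * z₂ ^ 2 * x)
    (b₂ := fun x => -(m + 6) - x * (5 + 2 * M * z₁) - 2 * M * z₂ * x ^ 2) (b₀ := m + 6) l₂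
    (fun x => by rw [hM']; linear_combination -h₂) (fun x => by rw [hM']; ring)
    (by fun_prop) (by fun_prop) (by linarith) (by ring)
  have r₃ : (-(3 + 2 * M * z₁) * z₂ - M * z₂ ^ 2 * 0) / (m + 6) = z₃ := by
    rw [div_eq_iff (by positivity), h₃]; ring
  rw [r₃] at l₃
  obtain ⟨g₄, k₄, l₄, d₄⟩ := k₃.step (c := z₃)
    (a₂ := fun x => -M * z₂ ^ 2 - (5 + 2 * M * z₁) * z₃ - 2 * M * z₂ * z₃ * x - M * z₃ ^ 2 * x ^ 2)
    (b₂ := fun x => -(m + 8) - x * (7 + 2 * M * z₁) - 2 * M * z₂ * x ^ 2 - 2 * M * z₃ * x ^ 3)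
    (b₀ := m + 8) l₃
    (fun x => by rw [hM']; linear_combination -h₃) (fun x => by rw [hM']; ring)
    (by fun_prop) (by fun_prop) (by linarith) (by ring)
  have r₄ : (-M * z₂ ^ 2 - (5 + 2 * M * z₁) * z₃ - 2 * M * z₂ * z₃ * 0 - M * z₃ ^ 2 * 0 ^ 2)
      / (m + 8) = z₄ := by
    rw [div_eq_iff (by positivity), h₄]; ring
  rw [r₄] at l₄
  obtain ⟨g₅, k₅, l₅, d₅⟩ := k₄.step (c := z₄)
    (a₂ := fun x => -2 * M * z₂ * z₃ - (7 + 2 * M * z₁) * z₄ - M * z₃ ^ 2 * x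
      - 2 * M * z₂ * z₄ * x - 2 * M * z₃ * z₄ * x ^ 2 - M * z₄ ^ 2 * x ^ 3)
    (b₂ := fun x => -(m + 10) - x * (9 + 2 * M * z₁) - 2 * M * z₂ * x ^ 2 - 2 * M * z₃ * x ^ 3
      - 2 * M * z₄ * x ^ 4)
    (b₀ := m + 10) l₄
    (fun x => by rw [hM']; linear_combination -h₄) (fun x => by rw [hM']; ring)
    (by fun_prop) (by fun_prop) (by linarith) (by ring)
  have r₅ : (-2 * M * z₂ * z₃ - (7 + 2 * M * z₁) * z₄ - M * z₃ ^ 2 * 0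
      - 2 * M * z₂ * z₄ * 0 - 2 * M * z₃ * z₄ * 0 ^ 2 - M * z₄ ^ 2 * 0 ^ 3) / (m + 10) = z₅ := by
    rw [div_eq_iff (by positivity), h₅]; ring
  rw [r₅] at l₅
  exact ⟨g₁, g₂, g₃, g₄, g₅, d₁, d₂, d₃, d₄, d₅, l₁, l₂, l₃, l₄, l₅⟩

/-- The leading coefficient of a solution of `2x(1+x) f' = (2(1+x+MZ) - 2j(1+x)) f` vanishes
unless `j` is the exponent `M + 1`. -/
lemma RiccatiNear.coeff_eq_zero {f q Z : ℝ → ℝ} {M c j : ℝ}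
    (h : RiccatiNear f (fun _ => 0) (fun x => 2 * (1 + x + M * Z x) - 2 * j * (1 + x)) 0 0)
    (hZ1 : Tendsto Z (𝓝[>] 0) (𝓝 1)) (hj : M + 1 ≠ j)
    (hfq : ∀ᶠ x in 𝓝[>] (0 : ℝ), f x = c + x * q x) (hf : Tendsto f (𝓝[>] 0) (𝓝 c)) :
    c = 0 ∧
    RiccatiNear q (fun _ => 0) (fun x => 2 * (1 + x + M * Z x) - 2 * (j + 1) * (1 + x)) 0 0 := by
  have hx := tendsto_id_nhdsGT_zero
  have hb : Tendsto (fun x => 2 * (1 + x + M * Z x) - 2 * j * (1 + x)) (𝓝[>] 0)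
      (𝓝 (2 * (1 + 0 + M * 1) - 2 * j * (1 + 0))) :=
    (((hx.const_add 1).add (hZ1.const_mul M)).const_mul 2).sub ((hx.const_add 1).const_mul _)
  have h0 := h.linear_limit tendsto_const_nhds hb hf
  have hc : c = 0 := by
    have : (M + 1 - j) * c = 0 := by linarith
    rcases mul_eq_zero.1 this with h | h
    · exact absurd (by linarith) hj
    · exact h
  refine ⟨hc, ?_⟩
  have := h.linear_step hfq (a₂ := fun _ => 0) (Eventually.of_forall fun x => by rw [hc]; ring)
  convert this using 2
  ring

lemma taylor_determinant {m M z₁ z₂ z₃ z₄ p₀ p₁ : ℝ} (hm : 0 < m) (hM : m = M + 1)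
    (h₁ : z₁ * (m + 2) = 2) (h₂ : z₂ * (m + 4) = -z₁ - M * z₁ ^ 2)
    (h₃ : z₃ * (m + 6) = -(3 + 2 * M * z₁) * z₂)
    (h₄ : z₄ * (m + 8) = -M * z₂ ^ 2 - (5 + 2 * M * z₁) * z₃)
    (e₂ : 6 * z₂ + 3 * z₁ ^ 2 + z₂ * p₀ + z₁ * p₁ = 0)
    (e₃ : 6 * z₃ + 6 * z₁ * z₂ + z₃ * p₀ + z₂ * p₁ = 0)
    (e₄ : 6 * z₄ + 3 * (2 * z₁ * z₃ + z₂ ^ 2) + z₄ * p₀ + z₃ * p₁ = 0) :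
    m = 2 ∨ m = 4 := by
  obtain rfl : M = m - 1 := by linarith
  have r₁ : z₁ = 2 / (m + 2) := by rw [eq_div_iff (by positivity), h₁]
  have r₂ : z₂ = -6 * m / ((m + 2) ^ 2 * (m + 4)) := by
    rw [eq_div_iff (by positivity)]
    rw [r₁] at h₂; field_simp at h₂; linear_combination h₂
  have r₃ : z₃ = 6 * m * (7 * m + 2) / ((m + 2) ^ 3 * (m + 4) * (m + 6)) := by
    rw [eq_div_iff (by positivity)]
    rw [r₁, r₂] at h₃; field_simp at h₃; linear_combination h₃
  have r₄ : z₄ = -m * (414 * m ^ 3 + 2052 * m ^ 2 + 1296 * m + 288) /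
      ((m + 2) ^ 4 * (m + 4) ^ 2 * (m + 6) * (m + 8)) := by
    rw [eq_div_iff (by positivity)]
    rw [r₁, r₂, r₃] at h₄; field_simp at h₄; linear_combination h₄
  have hdet : z₂ * (z₂ * (6 * z₁ * z₃ + 3 * z₂ ^ 2) - z₃ * (6 * z₁ * z₂))
      - z₁ * (z₃ * (6 * z₁ * z₃ + 3 * z₂ ^ 2) - z₄ * (6 * z₁ * z₂))
      + 3 * z₁ ^ 2 * (z₃ * z₃ - z₂ * z₄) = 0 := by
    linear_combination (z₃ * z₃ - z₂ * z₄) * e₂ - (z₂ * z₃ - z₁ * z₄) * e₃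
      + (z₂ * z₂ - z₁ * z₃) * e₄
  have hdet2 : 3456 * m ^ 2 * (m + 1) * (m + 5) * ((m - 2) * (m - 4)) /
      ((m + 2) ^ 7 * (m + 4) ^ 4 * (m + 6) ^ 2 * (m + 8)) = 0 := by
    rw [← hdet, r₁, r₂, r₃, r₄]
    field_simp
    ring
  have : (m - 2) * (m - 4) = 0 := by
    rw [div_eq_zero_iff] at hdet2
    rcases hdet2 with h | h
    · rcases mul_eq_zero.1 h with h | h
      · have : 0 < 3456 * m ^ 2 * (m + 1) * (m + 5) := by positivity
        exact absurd h this.ne'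
      · exact h
    · have : 0 < (m + 2) ^ 7 * (m + 4) ^ 4 * (m + 6) ^ 2 * (m + 8) := by positivity
      exact absurd h this.ne'
  rcases mul_eq_zero.1 this with h | h
  · left; linarith
  · right; linarith

lemma tendsto_affine_expr {f g h : ℝ → ℝ} {a b c : ℝ} (hf : Tendsto f (𝓝[>] 0) (𝓝 a))
    (hg : Tendsto g (𝓝[>] 0) (𝓝 b)) (hh : Tendsto h (𝓝[>] 0) (𝓝 c)) (p₀ p₁ u v r s t : ℝ) :
    Tendsto (fun x => 6 * f x + 3 * (u * g x + v * h x + r * h x ^ 2 + s * (x * h x ^ 2))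
      + f x * (p₀ + p₁ * x) + t) (𝓝[>] 0)
      (𝓝 (6 * a + 3 * (u * b + v * c + r * c ^ 2) + a * p₀ + t)) := by
  have hx := tendsto_id_nhdsGT_zero
  have := (((hf.const_mul 6).add (((((hg.const_mul u).add (hh.const_mul v)).add
    ((hh.pow 2).const_mul r)).add ((hx.mul (hh.pow 2)).const_mul s)).const_mul 3)).add
    (hf.mul ((hx.const_mul p₁).const_add p₀))).add_const t
  simpa using this

set_option maxHeartbeats 1000000 in
/-- A solution of the Riccati equation with `Z(0) = 1` for which
`3Z² + Z(p₀ + p₁x) + q₀ + q₁x` solves the linear equation with exponent `m` exists only for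
`m = 2` and `m = 4`. -/
lemma exponent_classification {m : ℝ} (hm : 0 < m) (hm1 : m ≠ 1) {Z H : ℝ → ℝ}
    (hZ : RiccatiNear Z (fun x => 1 + x) (fun x => x + m - 2) (m - 1) 0)
    (hZ1 : Tendsto Z (𝓝[>] 0) (𝓝 1))
    (hH : RiccatiNear H (fun _ => 0) (fun x => 2 * (1 + x + (m - 1) * Z x)) 0 0)
    {p₀ p₁ q₀ q₁ : ℝ}
    (hrel : ∀ᶠ x in 𝓝[>] (0 : ℝ),
      H x = 3 * Z x ^ 2 + Z x * (p₀ + p₁ * x) + q₀ + q₁ * x) :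
    m = 2 ∨ (m = 4 ∧ Tendsto (fun x => H x / x ^ 4) (𝓝[>] 0) (𝓝 0)) := by
  obtain ⟨M, hM⟩ : ∃ M, m = M + 1 := ⟨m - 1, by ring⟩
  have hM' : m - 1 = M := by linarith
  by_cases hm2 : m = 2
  · exact Or.inl hm2
  right
  obtain ⟨z₁, h₁⟩ : ∃ z₁, z₁ * (m + 2) = 2 := ⟨_, div_mul_cancel₀ _ (by positivity)⟩
  obtain ⟨z₂, h₂⟩ : ∃ z₂, z₂ * (m + 4) = -z₁ - M * z₁ ^ 2 :=
    ⟨_, div_mul_cancel₀ _ (by positivity)⟩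
  obtain ⟨z₃, h₃⟩ : ∃ z₃, z₃ * (m + 6) = -(3 + 2 * M * z₁) * z₂ :=
    ⟨_, div_mul_cancel₀ _ (by positivity)⟩
  obtain ⟨z₄, h₄⟩ : ∃ z₄, z₄ * (m + 8) = -M * z₂ ^ 2 - (5 + 2 * M * z₁) * z₃ :=
    ⟨_, div_mul_cancel₀ _ (by positivity)⟩
  obtain ⟨z₅, h₅⟩ : ∃ z₅, z₅ * (m + 10) = -2 * M * z₂ * z₃ - (7 + 2 * M * z₁) * z₄ :=
    ⟨_, div_mul_cancel₀ _ (by positivity)⟩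
  obtain ⟨g₁, g₂, g₃, g₄, g₅, d₁, d₂, d₃, d₄, d₅, l₁, l₂, l₃, l₄, l₅⟩ :=
    riccati_expansion hm hZ hZ1 hM h₁ h₂ h₃ h₄ h₅
  have t₁ := tendsto_affine_expr l₁ l₁ l₁ p₀ p₁ 0 0 0 1 (p₁ + q₁)
  have t₂ := tendsto_affine_expr l₂ l₂ l₁ p₀ p₁ 0 0 1 0 (z₁ * p₁)
  have t₃ := tendsto_affine_expr l₃ l₂ l₂ p₀ p₁ (2 * z₁) 0 0 1 (z₂ * p₁)
  have t₄ := tendsto_affine_expr l₄ l₃ l₂ p₀ p₁ (2 * z₁) 0 1 0 (z₃ * p₁)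
  have t₅ := tendsto_affine_expr l₅ l₄ l₃ p₀ p₁ (2 * z₁) (2 * z₂) 0 1 (z₄ * p₁)
  set E₁ := fun x => 6 * g₁ x + 3 * (0 * g₁ x + 0 * g₁ x + 0 * g₁ x ^ 2 + 1 * (x * g₁ x ^ 2))
    + g₁ x * (p₀ + p₁ * x) + (p₁ + q₁) with hE₁
  set E₂ := fun x => 6 * g₂ x + 3 * (0 * g₂ x + 0 * g₁ x + 1 * g₁ x ^ 2 + 0 * (x * g₁ x ^ 2))
    + g₂ x * (p₀ + p₁ * x) + (z₁ * p₁) with hE₂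
  set E₃ := fun x => 6 * g₃ x + 3 * (2 * z₁ * g₂ x + 0 * g₂ x + 0 * g₂ x ^ 2
    + 1 * (x * g₂ x ^ 2)) + g₃ x * (p₀ + p₁ * x) + (z₂ * p₁) with hE₃
  set E₄ := fun x => 6 * g₄ x + 3 * (2 * z₁ * g₃ x + 0 * g₂ x + 1 * g₂ x ^ 2
    + 0 * (x * g₂ x ^ 2)) + g₄ x * (p₀ + p₁ * x) + (z₃ * p₁) with hE₄
  set E₅ := fun x => 6 * g₅ x + 3 * (2 * z₁ * g₄ x + 2 * z₂ * g₃ x + 0 * g₃ x ^ 2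
    + 1 * (x * g₃ x ^ 2)) + g₅ x * (p₀ + p₁ * x) + (z₄ * p₁) with hE₅
  set c₁ := 6 * z₁ + 3 * (0 * z₁ + 0 * z₁ + 0 * z₁ ^ 2) + z₁ * p₀ + (p₁ + q₁) with hc₁
  set c₂ := 6 * z₂ + 3 * (0 * z₂ + 0 * z₁ + 1 * z₁ ^ 2) + z₂ * p₀ + (z₁ * p₁) with hc₂
  set c₃ := 6 * z₃ + 3 * (2 * z₁ * z₂ + 0 * z₂ + 0 * z₂ ^ 2) + z₃ * p₀ + (z₂ * p₁) with hc₃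
  set c₄ := 6 * z₄ + 3 * (2 * z₁ * z₃ + 0 * z₂ + 1 * z₂ ^ 2) + z₄ * p₀ + (z₃ * p₁) with hc₄
  set c₅ := 6 * z₅ + 3 * (2 * z₁ * z₄ + 2 * z₂ * z₃ + 0 * z₃ ^ 2) + z₅ * p₀ + (z₄ * p₁) with hc₅
  have s₀ : ∀ᶠ x in 𝓝[>] (0 : ℝ), H x = (3 + p₀ + q₀) + x * E₁ x := by
    filter_upwards [hrel, d₁] with x h d
    rw [h, d]; simp only [hE₁]; ring
  have s₁ : ∀ᶠ x in 𝓝[>] (0 : ℝ), E₁ x = c₁ + x * E₂ x := by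
    filter_upwards [d₂] with x d
    simp only [hE₁, hE₂, hc₁]
    linear_combination (6 + p₀ + p₁ * x) * d
  have s₂ : ∀ᶠ x in 𝓝[>] (0 : ℝ), E₂ x = c₂ + x * E₃ x := by
    filter_upwards [d₂, d₃] with x d d'
    simp only [hE₂, hE₃, hc₂]
    rw [d]
    linear_combination (6 + p₀ + p₁ * x) * d'
  have s₃ : ∀ᶠ x in 𝓝[>] (0 : ℝ), E₃ x = c₃ + x * E₄ x := by
    filter_upwards [d₃, d₄] with x d d'
    simp only [hE₃, hE₄, hc₃]
    linear_combination (6 + p₀ + p₁ * x) * d' + 6 * z₁ * d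
  have s₄ : ∀ᶠ x in 𝓝[>] (0 : ℝ), E₄ x = c₄ + x * E₅ x := by
    filter_upwards [d₃, d₄, d₅] with x d d' d''
    simp only [hE₄, hE₅, hc₄]
    rw [d]
    linear_combination (6 + p₀ + p₁ * x) * d'' + 6 * z₁ * d'
  have hx := tendsto_id_nhdsGT_zero
  have t₀ : Tendsto H (𝓝[>] 0) (𝓝 (3 + p₀ + q₀)) := by
    have := (hx.mul t₁).const_add (3 + p₀ + q₀)
    rw [zero_mul, add_zero] at this
    exact this.congr' (s₀.mono fun x h => h.symm)
  rw [hM'] at hH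
  have hH0 : RiccatiNear H (fun _ => 0)
      (fun x => 2 * (1 + x + M * Z x) - 2 * (0 : ℝ) * (1 + x)) 0 0 := by
    convert hH using 2; ring
  obtain ⟨y₀, w₁⟩ := hH0.coeff_eq_zero hZ1 (by linarith) s₀ t₀
  obtain ⟨y₁, w₂⟩ := w₁.coeff_eq_zero hZ1 (fun h => hm1 (by linarith)) s₁ t₁
  obtain ⟨y₂, w₃⟩ := w₂.coeff_eq_zero hZ1 (fun h => hm2 (by linarith)) s₂ t₂
  by_cases hm3 : m = 3
  · exfalso
    obtain rfl : M = 2 := by linarith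
    subst hm3
    have w₄ := w₃.linear_step s₃ (a₂ := fun x => c₃ * (4 * g₁ x - 4))
      (d₁.mono fun x h => by simp only [h]; ring)
    have hb : Tendsto (fun x => 2 * (1 + x + 2 * Z x) - 2 * (0 + 1 + 1 + 1) * (1 + x)
        - 2 * (1 + x)) (𝓝[>] 0) (𝓝 (-2)) := by
      have := ((((hx.const_add 1).add (hZ1.const_mul 2)).const_mul 2).sub
        ((hx.const_add 1).const_mul (2 * (0 + 1 + 1 + 1)))).sub ((hx.const_add 1).const_mul 2)
      convert this using 2
      norm_num
    have y₄ := w₄.linear_limit (((l₁.const_mul 4).sub_const 4).const_mul c₃) hb t₄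
    have w₅ := w₄.linear_step s₄ (a₂ := fun x => c₃ * (4 * g₂ x) + c₄ * (4 * g₁ x - 6))
      (by
        filter_upwards [d₁, d₂] with x h h'
        simp only [h]
        linear_combination y₄ + 4 * c₃ * h')
    have hb' := hb.sub ((hx.const_add 1).const_mul 2)
    have y₅ := w₅.linear_limit (((l₂.const_mul 4).const_mul c₃).add
      (((l₁.const_mul 4).sub_const 6).const_mul c₄)) hb' t₅
    obtain rfl : z₁ = 2 / 5 := by linarith
    obtain rfl : z₂ = -18 / 175 := by linarith
    obtain rfl : z₃ = 46 / 875 := by linarith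
    obtain rfl : z₄ = -11274 / 336875 := by linarith
    obtain rfl : z₅ = 521214 / 21896875 := by linarith
    rw [hc₂] at y₂
    have v₄ : c₄ = -6 / 5 * c₃ := by linarith
    have v₅ : c₅ = 213 / 175 * c₃ := by linarith
    rw [hc₄, hc₃] at v₄
    rw [hc₅, hc₃] at v₅
    linarith
  obtain ⟨y₃, w₄⟩ := w₃.coeff_eq_zero hZ1 (fun h => hm3 (by linarith)) s₃ t₃
  by_cases hm4 : m = 4
  · refine ⟨hm4, ?_⟩
    obtain rfl : M = 3 := by linarith
    subst hm4
    obtain rfl : z₁ = 1 / 3 := by linarith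
    obtain rfl : z₂ = -1 / 12 := by linarith
    obtain rfl : z₃ = 1 / 24 := by linarith
    obtain rfl : z₄ = -5 / 192 := by linarith
    have hc0 : c₄ = 0 := by
      rw [hc₄]; rw [hc₂] at y₂; rw [hc₃] at y₃; linarith
    rw [hc0] at t₄
    refine t₄.congr' ?_
    filter_upwards [s₀, s₁, s₂, s₃, self_mem_nhdsWithin] with x i₀ i₁ i₂ i₃ hpos
    have hx0 : x ≠ 0 := ne_of_gt hpos
    rw [i₀, i₁, i₂, i₃, y₀, y₁, y₂, y₃]
    field_simp
    ring
  · exfalso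
    obtain ⟨y₄, -⟩ := w₄.coeff_eq_zero hZ1 (fun h => hm4 (by linarith)) s₄ t₄
    rcases taylor_determinant (p₀ := p₀) (p₁ := p₁) hm hM h₁ h₂ h₃ h₄
      (by rw [← y₂, hc₂]; ring) (by rw [← y₃, hc₃]; ring) (by rw [← y₄, hc₄]; ring) with h | h
    · exact hm2 h
    · exact hm4 h

/-- The differential equation, positivity and normalization at `0⁺` that characterize the function
`φ` of the fourth class with parameters `b`, `k`, `m`. -/
structure IsFourthClass (b k m : ℝ) (φ : ℝ → ℝ) : Prop where
  pos : ∀ s ∈ Set.Ioo 0 b, 0 < φ s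
  hasDerivAt : ∀ s ∈ Set.Ioo 0 b, HasDerivAt φ
    ((m * b ^ 2 * (s / √(1 - k * s ^ 2)) ^ (m - 1) - s * φ s) / (b ^ 2 - s ^ 2)) s
  tendsto : Tendsto (fun s => φ s / s ^ m) (𝓝[>] 0) (𝓝 1)

lemma rpow_neg_three_halves {c : ℝ} (hc : 0 < c) : c ^ (-(3 / 2 : ℝ)) = (√c ^ 3)⁻¹ := by
  rw [Real.rpow_neg hc.le, Real.sqrt_eq_rpow, ← Real.rpow_natCast, ← Real.rpow_mul hc.le]
  norm_num

lemma hasDerivAt_sqrt_sq_sub {b s : ℝ} (h : 0 < b ^ 2 - s ^ 2) :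
    HasDerivAt (fun s => √(b ^ 2 - s ^ 2)) (-(2 * s) / (2 * √(b ^ 2 - s ^ 2))) s := by
  refine HasDerivAt.sqrt ?_ h.ne'
  refine ((hasDerivAt_pow 2 s).const_sub (b ^ 2)).congr_deriv ?_
  norm_num

lemma tendsto_sqrt_sq_sub {b : ℝ} (hb : 0 < b) :
    Tendsto (fun s => √(b ^ 2 - s ^ 2)) (𝓝[>] 0) (𝓝 b) := by
  have : ContinuousAt (fun s => √(b ^ 2 - s ^ 2)) 0 := by fun_prop
  have := this.tendsto
  rw [zero_pow two_ne_zero, sub_zero, Real.sqrt_sq hb.le] at this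
  exact tendsto_nhdsWithin_of_tendsto_nhds this

lemma tendsto_rpow_nhdsGT_zero {m : ℝ} (hm : 0 < m) :
    Tendsto (fun s : ℝ => s ^ m) (𝓝[>] 0) (𝓝 0) := by
  have := (Real.continuousAt_rpow_const 0 m (Or.inr hm.le)).tendsto
  rw [Real.zero_rpow hm.ne'] at this
  exact tendsto_nhdsWithin_of_tendsto_nhds this

lemma isFourthClass_of_integral {b k m : ℝ} (hb : 0 < b) (hm : 0 < m)
    (hk : ∀ t ∈ Set.Ico (0 : ℝ) b, 0 < 1 - k * t ^ 2) {φ : ℝ → ℝ}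
    (hφ : ∀ s ∈ Set.Ioo (0 : ℝ) b, φ s = m * b ^ 2 * √(b ^ 2 - s ^ 2) *
      ∫ t in (0 : ℝ)..s,
        (b ^ 2 - t ^ 2) ^ (-(3 / 2 : ℝ)) * (t / √(1 - k * t ^ 2)) ^ (m - 1)) :
    IsFourthClass b k m φ := by
  set f : ℝ → ℝ := fun t => (b ^ 2 - t ^ 2) ^ (-(3 / 2 : ℝ)) * (t / √(1 - k * t ^ 2)) ^ (m - 1)
    with hf
  set g : ℝ → ℝ := fun t => (b ^ 2 - t ^ 2) ^ (-(3 / 2 : ℝ)) * (1 / √(1 - k * t ^ 2)) ^ (m - 1)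
    with hg
  have hw : ∀ t ∈ Set.Ico (0 : ℝ) b, 0 < b ^ 2 - t ^ 2 := fun t ht => by
    have := ht.1; have := ht.2; nlinarith
  have hgc : ContinuousOn g (Set.Ico 0 b) := by
    refine ContinuousOn.mul (ContinuousOn.rpow_const (by fun_prop) fun t ht => Or.inl (hw t ht).ne')
      (ContinuousOn.rpow_const (ContinuousOn.div continuousOn_const (by fun_prop) fun t ht => ?_)
        fun t ht => Or.inl ?_)
    · exact (Real.sqrt_pos.2 (hk t ht)).ne'
    · exact (one_div_pos.2 (Real.sqrt_pos.2 (hk t ht))).ne'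
  have hfg : ∀ t ∈ Set.Ico (0 : ℝ) b, f t = t ^ (m - 1) * g t := fun t ht => by
    simp only [hf, hg]
    rw [div_eq_mul_one_div t, Real.mul_rpow ht.1 (by positivity)]
    ring
  have hfpos : ∀ t ∈ Set.Ioo (0 : ℝ) b, 0 < f t := fun t ht => by
    have := hw t ⟨ht.1.le, ht.2⟩
    have := Real.sqrt_pos.2 (hk t ⟨ht.1.le, ht.2⟩)
    have := ht.1
    simp only [hf]; positivity
  have hfc : ContinuousOn f (Set.Ioo 0 b) := by
    refine ContinuousOn.congr (f := fun t => t ^ (m - 1) * g t) ?_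
      fun t ht => hfg t ⟨ht.1.le, ht.2⟩
    exact ContinuousOn.mul (ContinuousOn.rpow_const continuousOn_id fun t ht => Or.inl ht.1.ne')
      (hgc.mono fun t ht => ⟨ht.1.le, ht.2⟩)
  have hint : ∀ s ∈ Set.Ioo (0 : ℝ) b, IntervalIntegrable f MeasureTheory.volume 0 s := by
    intro s hs
    have h1 : IntervalIntegrable (fun t : ℝ => t ^ (m - 1)) MeasureTheory.volume 0 s :=
      intervalIntegral.intervalIntegrable_rpow' (by linarith)
    have h2 := h1.mul_continuousOn (g := g) (hgc.mono (by
      rw [Set.uIcc_of_le hs.1.le]; exact fun t ht => ⟨ht.1, ht.2.trans_lt hs.2⟩))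
    refine h2.congr ?_
    rw [Set.uIoc_of_le hs.1.le]
    exact fun t ht => (hfg t ⟨ht.1.le, ht.2.trans_lt hs.2⟩).symm
  set J : ℝ → ℝ := fun s => ∫ t in (0 : ℝ)..s, f t with hJ
  have hJd : ∀ s ∈ Set.Ioo (0 : ℝ) b, HasDerivAt J (f s) s := fun s hs =>
    intervalIntegral.integral_hasDerivAt_right (hint s hs)
      (hfc.stronglyMeasurableAtFilter isOpen_Ioo s hs) (hfc.continuousAt (isOpen_Ioo.mem_nhds hs))
  have hsq : ∀ s ∈ Set.Ioo (0 : ℝ) b, 0 < √(b ^ 2 - s ^ 2) := fun s hs =>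
    Real.sqrt_pos.2 (hw s ⟨hs.1.le, hs.2⟩)
  have hnear : Set.Ioo 0 b ∈ 𝓝[>] (0 : ℝ) := Ioo_mem_nhdsGT hb
  refine ⟨fun s hs => ?_, fun s hs => ?_, ?_⟩
  · rw [hφ s hs]
    have := intervalIntegral.intervalIntegral_pos_of_pos_on (hint s hs)
      (fun t ht => hfpos t ⟨ht.1, ht.2.trans hs.2⟩) hs.1
    have := hsq s hs
    positivity
  · have hw0 := hw s ⟨hs.1.le, hs.2⟩
    have hr := hsq s hs
    have h1 := hasDerivAt_sqrt_sq_sub hw0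
    have h2 := ((h1.const_mul (m * b ^ 2)).mul (hJd s hs)).congr_of_eventuallyEq
      (f₁ := φ) (by filter_upwards [isOpen_Ioo.mem_nhds hs] with t ht using hφ t ht)
    refine h2.congr_deriv ?_
    have h3 : φ s = m * b ^ 2 * √(b ^ 2 - s ^ 2) * J s := hφ s hs
    rw [h3]
    simp only [hf]
    rw [rpow_neg_three_halves hw0]
    have h4 : b ^ 2 - s ^ 2 = √(b ^ 2 - s ^ 2) ^ 2 := (Real.sq_sqrt hw0.le).symm
    set r := √(b ^ 2 - s ^ 2)
    rw [h4]
    field_simp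
    ring
  · have hJ0 : Tendsto J (𝓝[>] 0) (𝓝 0) := by
      have hb2 : b / 2 ∈ Set.Ioo 0 b := ⟨by linarith, by linarith⟩
      have h1 := intervalIntegral.continuousOn_primitive_interval'
        (hint _ hb2) Set.left_mem_uIcc
      have h2 := h1 0 Set.left_mem_uIcc
      rw [ContinuousWithinAt, intervalIntegral.integral_same] at h2
      refine h2.mono_left (nhdsWithin_le_of_mem ?_)
      rw [Set.uIcc_of_le hb2.1.le]
      exact mem_of_superset (Ioo_mem_nhdsGT hb2.1) Set.Ioo_subset_Icc_self
    have hg0 : Tendsto g (𝓝[>] 0) (𝓝 ((b ^ 3)⁻¹)) := by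
      have h1 : Tendsto g (𝓝[Set.Ico 0 b] 0) (𝓝 (g 0)) := hgc 0 ⟨le_rfl, hb⟩
      have h2 : g 0 = (b ^ 3)⁻¹ := by
        simp only [hg]
        rw [rpow_neg_three_halves (by simpa using pow_pos hb 2)]
        simp [Real.sqrt_sq hb.le]
      rw [h2] at h1
      exact h1.mono_left (nhdsWithin_le_of_mem
        (mem_of_superset hnear Set.Ioo_subset_Ico_self))
    have hpow0 := tendsto_rpow_nhdsGT_zero hm
    have hq : Tendsto (fun s => J s / s ^ m) (𝓝[>] 0) (𝓝 ((b ^ 3)⁻¹ / m)) := by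
      refine HasDerivAt.lhopital_zero_nhdsGT (f' := f) (g' := fun s => m * s ^ (m - 1))
        (by filter_upwards [hnear] with s hs using hJd s hs) ?_ ?_ hJ0 hpow0 ?_
      · filter_upwards [hnear] with s hs using Real.hasDerivAt_rpow_const (Or.inl hs.1.ne')
      · filter_upwards [hnear] with s hs
        have := hs.1
        positivity
      · refine (hg0.div_const m).congr' ?_
        filter_upwards [hnear] with s hs
        rw [hfg s ⟨hs.1.le, hs.2⟩]
        have := Real.rpow_pos_of_pos hs.1 (m - 1)
        field_simp
    have hr0 := tendsto_sqrt_sq_sub hb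
    have := (hr0.const_mul (m * b ^ 2)).mul hq
    have e : m * b ^ 2 * b * ((b ^ 3)⁻¹ / m) = 1 := by field_simp
    rw [e] at this
    refine this.congr' ?_
    filter_upwards [hnear] with s hs
    rw [hφ s hs]
    ring

namespace IsFourthClass

variable {b k m : ℝ} {φ : ℝ → ℝ}

lemma tendsto_zero (h : IsFourthClass b k m φ) (hm : 0 < m) : Tendsto φ (𝓝[>] 0) (𝓝 0) := by
  have hpow0 := tendsto_rpow_nhdsGT_zero hm
  have := h.tendsto.mul hpow0
  rw [one_mul] at this
  refine this.congr' ?_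
  filter_upwards [self_mem_nhdsWithin] with s hs
  have := Real.rpow_pos_of_pos hs m
  field_simp

/-- Solutions of the differential equation of the fourth class that vanish at `0⁺` are unique. -/
lemma eq_of_hasDerivAt (h : IsFourthClass b k m φ) (hb : 0 < b) (hm : 0 < m) {ψ : ℝ → ℝ}
    (hψ : ∀ s ∈ Set.Ioo 0 b, HasDerivAt ψ
      ((m * b ^ 2 * (s / √(1 - k * s ^ 2)) ^ (m - 1) - s * ψ s) / (b ^ 2 - s ^ 2)) s)
    (hψ0 : Tendsto ψ (𝓝[>] 0) (𝓝 0)) : ∀ s ∈ Set.Ioo 0 b, φ s = ψ s := by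
  have hw : ∀ t ∈ Set.Ioo (0 : ℝ) b, 0 < b ^ 2 - t ^ 2 := fun t ht => by
    have := ht.1; have := ht.2; nlinarith
  set q : ℝ → ℝ := fun s => (φ s - ψ s) / √(b ^ 2 - s ^ 2) with hq
  have hqd : ∀ s ∈ Set.Ioo 0 b, HasDerivAt q 0 s := by
    intro s hs
    have hw0 := hw s hs
    have hr := Real.sqrt_pos.2 hw0
    have h1 := hasDerivAt_sqrt_sq_sub hw0
    refine (((h.hasDerivAt s hs).sub (hψ s hs)).div h1 hr.ne').congr_deriv ?_
    have h4 : b ^ 2 - s ^ 2 = √(b ^ 2 - s ^ 2) ^ 2 := (Real.sq_sqrt hw0.le).symm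
    set r := √(b ^ 2 - s ^ 2)
    rw [h4]
    simp only [Pi.sub_apply]
    field_simp
    ring
  have hq0 : Tendsto q (𝓝[>] 0) (𝓝 0) := by
    have hr0 := tendsto_sqrt_sq_sub hb
    have := ((h.tendsto_zero hm).sub hψ0).div hr0 hb.ne'
    rwa [sub_self, zero_div] at this
  intro s hs
  have hconst : ∀ t ∈ Set.Ioo 0 b, q t = q s := by
    intro t ht
    exact isOpen_Ioo.is_const_of_deriv_eq_zero isPreconnected_Ioo
      (fun x hx => (hqd x hx).differentiableAt.differentiableWithinAt)
      (fun x hx => (hqd x hx).deriv) ht hs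
  have h1 : Tendsto q (𝓝[>] 0) (𝓝 (q s)) := by
    refine tendsto_const_nhds.congr' ?_
    filter_upwards [Ioo_mem_nhdsGT hb] with t ht using (hconst t ht).symm
  have h2 := tendsto_nhds_unique h1 hq0
  simp only [hq] at h2
  rcases div_eq_zero_iff.1 h2 with h3 | h3
  · linarith
  · exact absurd h3 (Real.sqrt_pos.2 (hw s hs)).ne'

end IsFourthClass

lemma div_sqrt_rpow {s w : ℝ} (hs : 0 < s) (hw : 0 < w) (m : ℝ) :
    (s / √w) ^ (m - 1) = s ^ (m - 1) * w ^ ((1 - m) / 2) := by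
  rw [Real.div_rpow hs.le (Real.sqrt_nonneg w), Real.sqrt_eq_rpow, ← Real.rpow_mul hw.le,
    div_eq_mul_inv, ← Real.rpow_neg hw.le]
  congr 2
  ring

lemma hasDerivAt_one_sub_mul_sq (k s : ℝ) :
    HasDerivAt (fun s : ℝ => 1 - k * s ^ 2) (-(2 * k * s)) s := by
  refine (((hasDerivAt_pow 2 s).const_mul k).const_sub 1).congr_deriv ?_
  norm_num
  ring

lemma hasDerivAt_div_sqrt_rpow {k m s : ℝ} (hs : 0 < s) (hw : 0 < 1 - k * s ^ 2) :
    HasDerivAt (fun s : ℝ => (s / √(1 - k * s ^ 2)) ^ (m - 1))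
      ((m - 1) * (s / √(1 - k * s ^ 2)) ^ (m - 1) / (s * (1 - k * s ^ 2))) s := by
  have h1 := (hasDerivAt_one_sub_mul_sq k s).sqrt hw.ne'
  have hr := Real.sqrt_pos.2 hw
  have hd : 0 < s / √(1 - k * s ^ 2) := by positivity
  refine (((hasDerivAt_id s).div h1 hr.ne').rpow_const (p := m - 1)
    (Or.inl hd.ne')).congr_deriv ?_
  have e : (s / √(1 - k * s ^ 2)) ^ (m - 1 - 1)
      = (s / √(1 - k * s ^ 2)) ^ (m - 1) / (s / √(1 - k * s ^ 2)) := by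
    rw [Real.rpow_sub_one hd.ne']
  simp only [id, Pi.div_apply]
  rw [e]
  have h4 : 1 - k * s ^ 2 = √(1 - k * s ^ 2) ^ 2 := (Real.sq_sqrt hw.le).symm
  set X := (s / √(1 - k * s ^ 2)) ^ (m - 1)
  set r := √(1 - k * s ^ 2)
  have h5 : k * s ^ 2 = 1 - r ^ 2 := by linarith
  rw [h4]
  field_simp
  linear_combination (X * (m - 1)) * h5

lemma tendsto_one_sub_mul_sq (k : ℝ) :
    Tendsto (fun s : ℝ => 1 - k * s ^ 2) (𝓝[>] 0) (𝓝 1) := by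
  simpa using (((tendsto_id_nhdsGT_zero.pow 2).const_mul k).const_sub 1)

lemma tendsto_one_sub_mul_sq_rpow (k c : ℝ) :
    Tendsto (fun s : ℝ => (1 - k * s ^ 2) ^ c) (𝓝[>] 0) (𝓝 1) := by
  have := (tendsto_one_sub_mul_sq k).rpow_const (p := c) (Or.inl one_ne_zero)
  rwa [Real.one_rpow] at this

namespace IsFourthClass

variable {b k m : ℝ} {φ : ℝ → ℝ}

lemma eq_of_mul_sq_eq_one (h : IsFourthClass b k m φ) (hb : 0 < b) (hm : 0 < m)
    (hk : ∀ s ∈ Set.Ioo 0 b, 0 < 1 - k * s ^ 2) (hkb : k * b ^ 2 = 1) :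
    ∀ s ∈ Set.Ioo 0 b, φ s = s ^ m * (1 - s ^ 2 / b ^ 2) ^ ((1 - m) / 2) := by
  have e : ∀ s ∈ Set.Ioo 0 b, s * (s / √(1 - k * s ^ 2)) ^ (m - 1)
      = s ^ m * (1 - k * s ^ 2) ^ ((1 - m) / 2) := fun s hs => by
    rw [div_sqrt_rpow hs.1 (hk s hs), ← mul_assoc, Real.rpow_sub_one hs.1.ne',
      mul_div_cancel₀ _ hs.1.ne']
  have key := h.eq_of_hasDerivAt hb hm (ψ := fun s => s * (s / √(1 - k * s ^ 2)) ^ (m - 1)) ?_ ?_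
  · intro s hs
    rw [key s hs, e s hs]
    congr 2
    field_simp
    linear_combination -s ^ 2 * hkb
  · intro s hs
    have hw := hk s hs
    have := hs.1
    have hr : b ^ 2 - s ^ 2 = b ^ 2 * (1 - k * s ^ 2) := by linear_combination s ^ 2 * hkb
    refine ((hasDerivAt_id s).mul (hasDerivAt_div_sqrt_rpow hs.1 hw)).congr_deriv ?_
    rw [hr]
    simp only [id]
    set X := (s / √(1 - k * s ^ 2)) ^ (m - 1)
    obtain ⟨w, hwd⟩ : ∃ w, w = 1 - k * s ^ 2 := ⟨_, rfl⟩
    rw [← hwd] at hw ⊢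
    field_simp
    linear_combination X * b ^ 2 * hwd - X * s ^ 2 * hkb
  · have := (tendsto_rpow_nhdsGT_zero hm).mul (tendsto_one_sub_mul_sq_rpow k ((1 - m) / 2))
    rw [zero_mul] at this
    refine this.congr' ?_
    filter_upwards [Ioo_mem_nhdsGT hb] with s hs using (e s hs).symm

lemma eq_of_exponent_two (h : IsFourthClass b k 2 φ) (hb : 0 < b)
    (hk : ∀ s ∈ Set.Ioo 0 b, 0 < 1 - k * s ^ 2) (hkb : k * b ^ 2 ≠ 1) :
    ∀ s ∈ Set.Ioo 0 b,
      φ s = (2 * b / (1 - k * b ^ 2)) * (b * √(1 - k * s ^ 2) - √(b ^ 2 - s ^ 2)) := by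
  have hc : 1 - k * b ^ 2 ≠ 0 := fun h => hkb (by linarith)
  refine h.eq_of_hasDerivAt hb two_pos ?_ ?_
  · intro s hs
    have hw := hk s hs
    have hw0 : 0 < b ^ 2 - s ^ 2 := by have := hs.1; have := hs.2; nlinarith
    have hr := Real.sqrt_pos.2 hw0
    have hq := Real.sqrt_pos.2 hw
    have := ((((hasDerivAt_one_sub_mul_sq k s).sqrt hw.ne').const_mul b).sub
      (hasDerivAt_sqrt_sq_sub hw0)).const_mul (2 * b / (1 - k * b ^ 2))
    refine this.congr_deriv ?_
    rw [show (2 : ℝ) - 1 = 1 by norm_num, Real.rpow_one]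
    have h4 : b ^ 2 - s ^ 2 = √(b ^ 2 - s ^ 2) ^ 2 := (Real.sq_sqrt hw0.le).symm
    have h5 : √(1 - k * s ^ 2) ^ 2 = 1 - k * s ^ 2 := Real.sq_sqrt hw.le
    set r := √(b ^ 2 - s ^ 2)
    set q := √(1 - k * s ^ 2)
    obtain ⟨c, hcd⟩ : ∃ c, c = 1 - k * b ^ 2 := ⟨_, rfl⟩
    rw [h4, ← hcd]
    rw [← hcd] at hc
    field_simp
    linear_combination s * b * (h5 + k * h4 - hcd)
  · have h1 : Tendsto (fun s : ℝ => √(1 - k * s ^ 2)) (𝓝[>] 0) (𝓝 1) := by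
      simpa using (tendsto_one_sub_mul_sq k).sqrt
    have := ((h1.const_mul b).sub (tendsto_sqrt_sq_sub hb)).const_mul (2 * b / (1 - k * b ^ 2))
    simpa using this

lemma eq_of_exponent_four (h : IsFourthClass b k 4 φ) (hb : 0 < b)
    (hk : ∀ s ∈ Set.Ioo 0 b, 0 < 1 - k * s ^ 2) (hkb : k * b ^ 2 ≠ 1) :
    ∀ s ∈ Set.Ioo 0 b,
      φ s = (4 * b ^ 2 / (1 - k * b ^ 2) ^ 2) * (b * √(1 - k * s ^ 2) - √(b ^ 2 - s ^ 2)) ^ 2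
        / √(1 - k * s ^ 2) := by
  have hc : 1 - k * b ^ 2 ≠ 0 := fun h => hkb (by linarith)
  refine h.eq_of_hasDerivAt hb four_pos ?_ ?_
  · intro s hs
    have hw := hk s hs
    have hw0 : 0 < b ^ 2 - s ^ 2 := by have := hs.1; have := hs.2; nlinarith
    have hr := Real.sqrt_pos.2 hw0
    have hq := Real.sqrt_pos.2 hw
    have hq' := (hasDerivAt_one_sub_mul_sq k s).sqrt hw.ne'
    have := ((((hq'.const_mul b).sub (hasDerivAt_sqrt_sq_sub hw0)).pow 2).const_mul
      (4 * b ^ 2 / (1 - k * b ^ 2) ^ 2)).div hq' hq.ne'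
    refine this.congr_deriv ?_
    rw [show (4 : ℝ) - 1 = (3 : ℕ) by norm_num, Real.rpow_natCast]
    have h4 : b ^ 2 - s ^ 2 = √(b ^ 2 - s ^ 2) ^ 2 := (Real.sq_sqrt hw0.le).symm
    have h5 : √(1 - k * s ^ 2) ^ 2 = 1 - k * s ^ 2 := Real.sq_sqrt hw.le
    simp only [Pi.sub_apply, Pi.pow_apply]
    set r := √(b ^ 2 - s ^ 2)
    set q := √(1 - k * s ^ 2)
    obtain ⟨c, hcd⟩ : ∃ c, c = 1 - k * b ^ 2 := ⟨_, rfl⟩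
    rw [h4, ← hcd]
    rw [← hcd] at hc
    field_simp
    simp only [Nat.cast_ofNat, Nat.add_one_sub_one, pow_one]
    have e₁ : c = q ^ 2 - k * r ^ 2 := by linear_combination hcd - h5 - k * h4
    have e₂ : c * s ^ 2 = b ^ 2 * q ^ 2 - r ^ 2 := by
      linear_combination s ^ 2 * hcd - b ^ 2 * h5 - h4
    linear_combination s * (-(b ^ 2 * q ^ 2 - r ^ 2) * e₁ - c * e₂)
  · have h1 : Tendsto (fun s : ℝ => √(1 - k * s ^ 2)) (𝓝[>] 0) (𝓝 1) := by
      simpa using (tendsto_one_sub_mul_sq k).sqrt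
    have := (((((h1.const_mul b).sub (tendsto_sqrt_sq_sub hb)).pow 2).const_mul
      (4 * b ^ 2 / (1 - k * b ^ 2) ^ 2))).div h1 one_ne_zero
    rw [mul_one, sub_self, zero_pow two_ne_zero, mul_zero, zero_div] at this
    exact this

end IsFourthClass

/-- The function `z = w (s φ'/φ - 1)/(m - 1)`, where `w = 1 - k s²`, rewritten by means of the
differential equation of the fourth class. -/
def fourthZ (b k m : ℝ) (φ : ℝ → ℝ) (s : ℝ) : ℝ :=
  (1 - k * s ^ 2) / ((m - 1) * (1 - s ^ 2 / b ^ 2))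
    * (m * s * (s / √(1 - k * s ^ 2)) ^ (m - 1) / φ s - 1)

/-- The change of variable `s = b √(x / (x + c))`, where `c = 1 - k b²`. -/
def fourthArg (b k x : ℝ) : ℝ := b * √(x / (x + (1 - k * b ^ 2)))

lemma one_sub_sq_div_sq_pos {b s : ℝ} (hs : s ∈ Set.Ioo 0 b) : 0 < 1 - s ^ 2 / b ^ 2 := by
  have h1 := hs.1
  have h2 := hs.2
  have : 0 < b ^ 2 := by have := h1.trans h2; positivity
  rw [sub_pos, div_lt_one this]
  nlinarith

section fourthArg

variable {b k x : ℝ}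

lemma fourthArg_sq (hkb : k * b ^ 2 < 1) (hx : 0 < x) :
    fourthArg b k x ^ 2 = b ^ 2 * (x / (x + (1 - k * b ^ 2))) := by
  have hc : 0 < x + (1 - k * b ^ 2) := by linarith
  rw [fourthArg, mul_pow, Real.sq_sqrt (by positivity)]

lemma fourthArg_mem (hb : 0 < b) (hkb : k * b ^ 2 < 1) (hx : 0 < x) :
    fourthArg b k x ∈ Set.Ioo 0 b := by
  have hc : 0 < x + (1 - k * b ^ 2) := by linarith
  have hpos : 0 < fourthArg b k x := mul_pos hb (Real.sqrt_pos.2 (by positivity))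
  refine ⟨hpos, lt_of_pow_lt_pow_left₀ 2 hb.le ?_⟩
  rw [fourthArg_sq hkb hx]
  have : x / (x + (1 - k * b ^ 2)) < 1 := by rw [div_lt_one hc]; linarith
  nlinarith [pow_pos hb 2]

lemma one_sub_fourthArg_sq_div (hb : 0 < b) (hkb : k * b ^ 2 < 1) (hx : 0 < x) :
    1 - fourthArg b k x ^ 2 / b ^ 2 = (1 - k * b ^ 2) / (x + (1 - k * b ^ 2)) := by
  have hc : 0 < x + (1 - k * b ^ 2) := by linarith
  rw [fourthArg_sq hkb hx, mul_div_cancel_left₀ _ (by positivity), one_sub_div hc.ne',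
    add_sub_cancel_left]

lemma one_sub_mul_fourthArg_sq (hb : 0 < b) (hkb : k * b ^ 2 < 1) (hx : 0 < x) :
    1 - k * fourthArg b k x ^ 2 = (1 + x) * (1 - fourthArg b k x ^ 2 / b ^ 2) := by
  have hc : 0 < x + (1 - k * b ^ 2) := by linarith
  rw [one_sub_fourthArg_sq_div hb hkb hx, fourthArg_sq hkb hx]
  field_simp
  ring

lemma hasDerivAt_fourthArg (hb : 0 < b) (hkb : k * b ^ 2 < 1) (hx : 0 < x) :
    HasDerivAt (fourthArg b k)
      (fourthArg b k x * (1 - fourthArg b k x ^ 2 / b ^ 2) / (2 * x)) x := by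
  rw [one_sub_fourthArg_sq_div hb hkb hx]
  obtain ⟨c, hcd⟩ : ∃ c, c = 1 - k * b ^ 2 := ⟨_, rfl⟩
  have hc : 0 < c := by linarith
  unfold fourthArg
  rw [← hcd]
  have hq : 0 < x / (x + c) := by positivity
  refine ((((hasDerivAt_id x).div ((hasDerivAt_id x).add_const c) (by positivity)).sqrt
    hq.ne').const_mul b).congr_deriv ?_
  simp only [id, Pi.div_apply]
  have hr := Real.sqrt_pos.2 hq
  have hr2 := Real.sq_sqrt hq.le
  set r := √(x / (x + c))
  rw [eq_div_iff (by positivity)] at hr2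
  field_simp
  linear_combination -c * hr2

lemma tendsto_fourthArg (hb : 0 < b) (hkb : k * b ^ 2 < 1) :
    Tendsto (fourthArg b k) (𝓝[>] 0) (𝓝[>] 0) := by
  refine tendsto_nhdsWithin_iff.2 ⟨?_, ?_⟩
  · have hc : 0 + (1 - k * b ^ 2) ≠ 0 := by linarith
    have := ((tendsto_id_nhdsGT_zero.div (tendsto_id_nhdsGT_zero.add_const (1 - k * b ^ 2))
      hc).sqrt).const_mul b
    simp only [zero_div, Real.sqrt_zero, mul_zero] at this
    exact this
  · filter_upwards [self_mem_nhdsWithin] with x hx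
    exact (fourthArg_mem hb hkb hx).1

end fourthArg

namespace IsFourthClass

variable {b k m : ℝ} {φ : ℝ → ℝ}

lemma hasDerivAt_eq (h : IsFourthClass b k m φ) (hm1 : m ≠ 1)
    (hk : ∀ s ∈ Set.Ioo 0 b, 0 < 1 - k * s ^ 2) {s : ℝ} (hs : s ∈ Set.Ioo 0 b) :
    HasDerivAt φ (φ s / s * (1 + (m - 1) * fourthZ b k m φ s / (1 - k * s ^ 2))) s := by
  refine (h.hasDerivAt s hs).congr_deriv ?_
  have hu := one_sub_sq_div_sq_pos hs
  have hw := hk s hs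
  have hs0 := hs.1
  have hb : 0 < b := hs.1.trans hs.2
  have hM : m - 1 ≠ 0 := sub_ne_zero.2 hm1
  have hφ := h.pos s hs
  have e : b ^ 2 - s ^ 2 = b ^ 2 * (1 - s ^ 2 / b ^ 2) := by field_simp
  have e' : s ^ 2 = b ^ 2 * (1 - (1 - s ^ 2 / b ^ 2)) := by field_simp; ring
  rw [fourthZ, e]
  set X := (s / √(1 - k * s ^ 2)) ^ (m - 1)
  set w := 1 - k * s ^ 2
  set u := 1 - s ^ 2 / b ^ 2
  field_simp
  linear_combination (-φ s) * e'

lemma hasDerivAt_fourthZ (h : IsFourthClass b k m φ) (hm : 0 < m) (hm1 : m ≠ 1)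
    (hk : ∀ s ∈ Set.Ioo 0 b, 0 < 1 - k * s ^ 2) {s : ℝ} (hs : s ∈ Set.Ioo 0 b) :
    HasDerivAt (fourthZ b k m φ)
      (((fourthZ b k m φ s + 1) / (1 - s ^ 2 / b ^ 2)
        + ((m - 3) * fourthZ b k m φ s - (m - 1) * fourthZ b k m φ s ^ 2) / (1 - k * s ^ 2)) / s)
      s := by
  have hu := one_sub_sq_div_sq_pos hs
  have hw := hk s hs
  have hs0 := hs.1
  have hb : 0 < b := hs.1.trans hs.2
  have hM : m - 1 ≠ 0 := sub_ne_zero.2 hm1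
  have hφ := h.pos s hs
  have du : HasDerivAt (fun s : ℝ => (m - 1) * (1 - s ^ 2 / b ^ 2))
      ((m - 1) * (-(2 * s / b ^ 2))) s := by
    refine ((((hasDerivAt_pow 2 s).div_const (b ^ 2)).const_sub 1).const_mul (m - 1)).congr_deriv ?_
    norm_num
  have key := ((hasDerivAt_one_sub_mul_sq k s).div du (by positivity)).mul
    (((((hasDerivAt_id s).const_mul m).mul (hasDerivAt_div_sqrt_rpow (m := m) hs.1 hw)).div
      (h.hasDerivAt_eq hm1 hk hs) hφ.ne').sub_const 1)
  refine key.congr_deriv ?_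
  obtain ⟨Y, hY⟩ : ∃ Y, Y = m * s * (s / √(1 - k * s ^ 2)) ^ (m - 1) / φ s - 1 := ⟨_, rfl⟩
  obtain ⟨u, hud⟩ : ∃ u, u = 1 - s ^ 2 / b ^ 2 := ⟨_, rfl⟩
  obtain ⟨w, hwd⟩ : ∃ w, w = 1 - k * s ^ 2 := ⟨_, rfl⟩
  have hz : fourthZ b k m φ s = w / ((m - 1) * u) * Y := by rw [fourthZ, hY, hud, hwd]
  have hX : (s / √(1 - k * s ^ 2)) ^ (m - 1) = (Y + 1) * φ s / (m * s) := by
    rw [hY]; field_simp; ring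
  have hb2 : 2 * s / b ^ 2 = 2 * (1 - u) / s := by rw [hud]; field_simp; ring
  have hk2 : 2 * k * s = 2 * (1 - w) / s := by rw [hwd]; field_simp; ring
  simp only [hz, Pi.mul_apply, Pi.div_apply, id]
  rw [hX, hb2, hk2, ← hwd, ← hud]
  rw [← hwd] at hw
  rw [← hud] at hu
  field_simp
  ring

lemma tendsto_fourthZ (h : IsFourthClass b k m φ) (hb : 0 < b) (hm1 : m ≠ 1)
    (hk : ∀ s ∈ Set.Ioo 0 b, 0 < 1 - k * s ^ 2) :
    Tendsto (fourthZ b k m φ) (𝓝[>] 0) (𝓝 1) := by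
  have hM : m - 1 ≠ 0 := sub_ne_zero.2 hm1
  have hu : Tendsto (fun s : ℝ => (m - 1) * (1 - s ^ 2 / b ^ 2)) (𝓝[>] 0) (𝓝 (m - 1)) := by
    simpa using ((((tendsto_id_nhdsGT_zero.pow 2).div_const (b ^ 2)).const_sub 1).const_mul (m - 1))
  have := ((tendsto_one_sub_mul_sq k).div hu hM).mul
    ((((tendsto_one_sub_mul_sq_rpow k ((1 - m) / 2)).const_mul m).div h.tendsto
      one_ne_zero).sub_const 1)
  rw [mul_one, div_one, one_div_mul_cancel hM] at this
  refine this.congr' ?_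
  filter_upwards [Ioo_mem_nhdsGT hb] with s hs
  have hs0 := hs.1
  have hφ := h.pos s hs
  rw [fourthZ, div_sqrt_rpow hs.1 (hk s hs)]
  simp only [Pi.div_apply]
  rw [Real.rpow_sub_one hs0.ne']
  have := Real.rpow_pos_of_pos hs0 m
  congr 2
  field_simp

lemma riccatiNear_fourthZ (h : IsFourthClass b k m φ) (hb : 0 < b) (hm : 0 < m) (hm1 : m ≠ 1)
    (hk : ∀ s ∈ Set.Ioo 0 b, 0 < 1 - k * s ^ 2) (hkb : k * b ^ 2 < 1) :
    RiccatiNear (fun x => fourthZ b k m φ (fourthArg b k x)) (fun x => 1 + x)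
      (fun x => x + m - 2) (m - 1) 0 := by
  refine .of_exists fun x hx => ?_
  have hmem := fourthArg_mem hb hkb hx
  refine ⟨_, (h.hasDerivAt_fourthZ hm hm1 hk hmem).comp x (hasDerivAt_fourthArg hb hkb hx), ?_⟩
  have hu := one_sub_sq_div_sq_pos hmem
  have hs := hmem.1
  rw [one_sub_mul_fourthArg_sq hb hkb hx]
  obtain ⟨u, hud⟩ : ∃ u, u = 1 - fourthArg b k x ^ 2 / b ^ 2 := ⟨_, rfl⟩
  rw [← hud] at hu ⊢
  field_simp
  ring

/-- The function `φ²/u`, with `u = 1 - s²/b²`, satisfies a linear equation in the variable `x`. -/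
lemma riccatiNear_sq_div (h : IsFourthClass b k m φ) (hb : 0 < b) (hm1 : m ≠ 1)
    (hk : ∀ s ∈ Set.Ioo 0 b, 0 < 1 - k * s ^ 2) (hkb : k * b ^ 2 < 1) (c : ℝ) :
    RiccatiNear
      (fun x => c * (φ (fourthArg b k x) ^ 2 / (1 - fourthArg b k x ^ 2 / b ^ 2)))
      (fun _ => 0) (fun x => 2 * (1 + x + (m - 1) * fourthZ b k m φ (fourthArg b k x))) 0 0 := by
  refine .of_exists fun x hx => ?_
  have hmem := fourthArg_mem hb hkb hx
  have hu := one_sub_sq_div_sq_pos hmem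
  have hs := hmem.1
  have hσ := hasDerivAt_fourthArg hb hkb hx
  have du := (((hσ.pow 2).div_const (b ^ 2)).const_sub 1)
  have dφ := (((h.hasDerivAt_eq hm1 hk hmem).comp x hσ).pow 2)
  refine ⟨_, (dφ.div du hu.ne').const_mul c, ?_⟩
  rw [one_sub_mul_fourthArg_sq hb hkb hx]
  simp only [Function.comp_apply, Pi.pow_apply]
  have hb2 : fourthArg b k x ^ 2 = b ^ 2 * (1 - (1 - fourthArg b k x ^ 2 / b ^ 2)) := by
    field_simp; ring
  set u := 1 - fourthArg b k x ^ 2 / b ^ 2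
  set s := fourthArg b k x
  field_simp
  norm_num
  linear_combination (2 * c * φ s ^ 2 * u * (1 + x)) * hb2

lemma fourthZ_eq_one (h : IsFourthClass b k m φ) (hb : 0 < b) (hm : 0 < m) (hm1 : m ≠ 1)
    (hk : ∀ s ∈ Set.Ioo 0 b, 0 < 1 - k * s ^ 2) (hkb : k * b ^ 2 = 1) {s : ℝ}
    (hs : s ∈ Set.Ioo 0 b) : fourthZ b k m φ s = 1 := by
  have hM : m - 1 ≠ 0 := sub_ne_zero.2 hm1
  have hw := hk s hs
  have hu : 1 - s ^ 2 / b ^ 2 = 1 - k * s ^ 2 := by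
    field_simp
    linear_combination s ^ 2 * hkb
  have hs0 := hs.1
  have := Real.rpow_pos_of_pos hs0 m
  have := Real.rpow_pos_of_pos hw ((1 - m) / 2)
  rw [fourthZ, h.eq_of_mul_sq_eq_one hb hm hk hkb s hs, hu, div_sqrt_rpow hs0 hw,
    Real.rpow_sub_one hs0.ne']
  field_simp

/-- When `k b² = 1`, the function `φ²` is an affine function of `s²` only up to the factor `0`. -/
lemma eq_zero_of_affine (h : IsFourthClass b k m φ) (hb : 0 < b) (hm : 0 < m) (hm1 : m ≠ 1)
    (hk : ∀ s ∈ Set.Ioo 0 b, 0 < 1 - k * s ^ 2) (hkb : k * b ^ 2 = 1) {K f₀ f₁ : ℝ}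
    (hf : ∀ s ∈ Set.Ioo 0 b, f₀ + f₁ * s ^ 2 = K * φ s ^ 2) : K = 0 := by
  have hf0 : f₀ = 0 := by
    have h1 : Tendsto (fun s : ℝ => f₀ + f₁ * s ^ 2) (𝓝[>] 0) (𝓝 f₀) := by
      simpa using ((tendsto_id_nhdsGT_zero.pow 2).const_mul f₁).const_add f₀
    have h2 : Tendsto (fun s : ℝ => K * φ s ^ 2) (𝓝[>] 0) (𝓝 0) := by
      simpa using ((h.tendsto_zero hm).pow 2).const_mul K
    refine tendsto_nhds_unique h1 (h2.congr' ?_)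
    filter_upwards [Ioo_mem_nhdsGT hb] with s hs using (hf s hs).symm
  have hs : b / 2 ∈ Set.Ioo 0 b := ⟨by linarith, by linarith⟩
  have hd := (((hasDerivAt_pow 2 (b / 2)).const_mul f₁).const_add f₀).unique
    ((((h.hasDerivAt_eq hm1 hk hs).pow 2).const_mul K).congr_of_eventuallyEq
      (by filter_upwards [isOpen_Ioo.mem_nhds hs] with t ht using hf t ht))
  rw [h.fourthZ_eq_one hb hm hm1 hk hkb hs] at hd
  have he := hf _ hs
  have hw := hk _ hs
  have hφ := h.pos _ hs
  set s := b / 2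
  have hs0 := hs.1
  norm_num at hd
  field_simp at hd
  rw [hf0, zero_add] at he
  have : K * φ s ^ 2 * ((m - 1) / (1 - k * s ^ 2)) = 0 := by linear_combination he - hd
  have hM : m - 1 ≠ 0 := sub_ne_zero.2 hm1
  simpa [hM, hφ.ne', hw.ne'] using this

end IsFourthClass

lemma mul_sq_le_one_of_forall {b k : ℝ} (hb : 0 < b)
    (hk : ∀ s ∈ Set.Ioo 0 b, 0 < 1 - k * s ^ 2) : k * b ^ 2 ≤ 1 := by
  have h1 : Tendsto (fun s : ℝ => 1 - k * s ^ 2) (𝓝[<] b) (𝓝 (1 - k * b ^ 2)) := by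
    have : ContinuousAt (fun s : ℝ => 1 - k * s ^ 2) b := by fun_prop
    exact tendsto_nhdsWithin_of_tendsto_nhds this
  have := ge_of_tendsto h1 (b := 0)
    (by filter_upwards [Ioo_mem_nhdsLT hb] with s hs using (hk s hs).le)
  linarith

lemma IsFourthClass.eq_zero_of_tendsto_zero {b k K S : ℝ} {φ : ℝ → ℝ}
    (h : IsFourthClass b k 4 φ) (hb : 0 < b) (hkb : k * b ^ 2 < 1) (hS : 0 < S)
    (hlim : Tendsto (fun x => K * b ^ 4 / S ^ 2 *
      (φ (fourthArg b k x) ^ 2 / (1 - fourthArg b k x ^ 2 / b ^ 2)) / x ^ 4) (𝓝[>] 0) (𝓝 0)) :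
    K = 0 := by
  obtain ⟨c, hcd⟩ : ∃ c, c = 1 - k * b ^ 2 := ⟨_, rfl⟩
  have hc : 0 < c := by linarith
  have ht := tendsto_fourthArg hb hkb
  have ht0 := tendsto_nhds_of_tendsto_nhdsWithin ht
  have h1 := (((h.tendsto.comp ht).pow 2).mul
    ((((ht0.pow 2).div_const (b ^ 2)).const_sub 1).pow 3)).const_mul
      (K * b ^ 4 / S ^ 2 * (b ^ 8 / c ^ 4))
  have h2 := tendsto_nhds_unique hlim (h1.congr' ?_)
  · have : K * b ^ 4 / S ^ 2 * (b ^ 8 / c ^ 4) = 0 := by simpa using h2.symm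
    simpa [hb.ne', hS.ne', hc.ne'] using this
  · filter_upwards [self_mem_nhdsWithin] with x hx
    have hx' : 0 < x := hx
    have hxc : 0 < x + c := by linarith
    have hs0 := (fourthArg_mem hb hkb hx).1
    have hs2 := fourthArg_sq hkb hx
    have hs8 : fourthArg b k x ^ 8 = (b ^ 2 * (x / (x + c))) ^ 4 := by rw [hcd, ← hs2]; ring
    simp only [Function.comp_apply]
    rw [show (4 : ℝ) = (4 : ℕ) by norm_num, Real.rpow_natCast, div_pow, ← pow_mul, hs8,
      one_sub_fourthArg_sq_div hb hkb hx, ← hcd]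
    field_simp

/-- A function of the fourth class satisfying the functional equation that constant flag
curvature `K` imposes is one of three explicit functions. -/
theorem IsFourthClass.classification {b k m : ℝ} {φ : ℝ → ℝ} (h : IsFourthClass b k m φ)
    (hb : 0 < b) (hm : 0 < m) (hm1 : m ≠ 1)
    (hk : ∀ s ∈ Set.Ioo 0 b, 0 < 1 - k * s ^ 2) {K A₁ A₂ B₁ B₂ S : ℝ} (hS : 0 < S)
    (hfun : ∀ s ∈ Set.Ioo 0 b,
      A₁ * (s ^ 2 / b ^ 2) + A₂ * (1 - s ^ 2 / b ^ 2)
        + (1 + fourthZ b k m φ s) / b ^ 2 * (B₁ * (s ^ 2 / b ^ 2) + B₂ * (1 - s ^ 2 / b ^ 2))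
        + S ^ 2 / b ^ 4 * (1 - s ^ 2 / b ^ 2) * ((1 + fourthZ b k m φ s) ^ 2
          - 2 * s * deriv (fourthZ b k m φ) s * (1 - k * s ^ 2) / (m - 1))
      = K * φ s ^ 2) :
    ((∀ s ∈ Set.Ioo (0 : ℝ) b,
        φ s = s ^ m * (1 - s ^ 2 / b ^ 2) ^ ((1 - m) / 2)) ∧ K = 0)
    ∨ (k * b ^ 2 ≠ 1 ∧
        ∀ s ∈ Set.Ioo (0 : ℝ) b,
          φ s = (2 * b / (1 - k * b ^ 2))
            * (b * Real.sqrt (1 - k * s ^ 2) - Real.sqrt (b ^ 2 - s ^ 2)))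
    ∨ (k * b ^ 2 ≠ 1 ∧
        (∀ s ∈ Set.Ioo (0 : ℝ) b,
          φ s = (4 * b ^ 2 / (1 - k * b ^ 2) ^ 2)
            * (b * Real.sqrt (1 - k * s ^ 2) - Real.sqrt (b ^ 2 - s ^ 2)) ^ 2
            / Real.sqrt (1 - k * s ^ 2)) ∧ K = 0) := by
  have hM : m - 1 ≠ 0 := sub_ne_zero.2 hm1
  rcases (mul_sq_le_one_of_forall hb hk).lt_or_eq with hkb | hkb
  · right
    have hrel : ∃ p₀ p₁ q₀ q₁ : ℝ, ∀ x, 0 < x →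
        K * b ^ 4 / S ^ 2 * (φ (fourthArg b k x) ^ 2 / (1 - fourthArg b k x ^ 2 / b ^ 2))
          = 3 * fourthZ b k m φ (fourthArg b k x) ^ 2
            + fourthZ b k m φ (fourthArg b k x) * (p₀ + p₁ * x) + q₀ + q₁ * x := by
      refine ⟨b ^ 2 / S ^ 2 * B₂ + 2 - 2 / (m - 1) - 2 * (m - 3) / (m - 1),
        b ^ 2 / S ^ 2 * B₁ / (1 - k * b ^ 2) - 2 / (m - 1),
        b ^ 4 / S ^ 2 * A₂ + b ^ 2 / S ^ 2 * B₂ + 1 - 2 / (m - 1),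
        b ^ 4 / S ^ 2 * A₁ / (1 - k * b ^ 2) + b ^ 2 / S ^ 2 * B₁ / (1 - k * b ^ 2) - 2 / (m - 1),
        fun x hx => ?_⟩
      have hmem := fourthArg_mem hb hkb hx
      have hu := one_sub_sq_div_sq_pos hmem
      have hs := hmem.1
      have e := hfun _ hmem
      rw [(h.hasDerivAt_fourthZ hm hm1 hk hmem).deriv] at e
      have hs2 : fourthArg b k x ^ 2 / b ^ 2
          = x / (1 - k * b ^ 2) * (1 - fourthArg b k x ^ 2 / b ^ 2) := by
        have : 0 < x + (1 - k * b ^ 2) := by linarith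
        rw [one_sub_fourthArg_sq_div hb hkb hx, fourthArg_sq hkb hx]
        obtain ⟨c, hcd⟩ : ∃ c, c = 1 - k * b ^ 2 := ⟨_, rfl⟩
        have hc : 0 < c := by linarith
        rw [← hcd] at this ⊢
        field_simp
      rw [one_sub_mul_fourthArg_sq hb hkb hx] at e
      obtain ⟨u, hud⟩ : ∃ u, u = 1 - fourthArg b k x ^ 2 / b ^ 2 := ⟨_, rfl⟩
      obtain ⟨c, hcd⟩ : ∃ c, c = 1 - k * b ^ 2 := ⟨_, rfl⟩
      have hc : 0 < c := by linarith
      rw [← hud] at hu hs2 e ⊢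
      rw [hs2] at e
      rw [← hcd] at e ⊢
      have e' : K * b ^ 4 / S ^ 2 * (φ (fourthArg b k x) ^ 2 / u)
          = b ^ 4 / (S ^ 2 * u) * (K * φ (fourthArg b k x) ^ 2) := by
        field_simp
      rw [e', ← e]
      field_simp
      ring
    obtain ⟨p₀, p₁, q₀, q₁, hrel⟩ := hrel
    rcases exponent_classification hm hm1 (h.riccatiNear_fourthZ hb hm hm1 hk hkb)
      ((h.tendsto_fourthZ hb hm1 hk).comp (tendsto_fourthArg hb hkb))
      (h.riccatiNear_sq_div hb hm1 hk hkb (K * b ^ 4 / S ^ 2))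
      (by filter_upwards [self_mem_nhdsWithin] with x hx using hrel x hx) with rfl | ⟨rfl, hlim⟩
    · exact Or.inl ⟨hkb.ne, h.eq_of_exponent_two hb hk hkb.ne⟩
    · refine Or.inr ⟨hkb.ne, h.eq_of_exponent_four hb hk hkb.ne, ?_⟩
      exact h.eq_zero_of_tendsto_zero hb hkb hS hlim
  · left
    refine ⟨h.eq_of_mul_sq_eq_one hb hm hk hkb, ?_⟩
    refine h.eq_zero_of_affine hb hm hm1 hk hkb (f₀ := A₂ + 2 * B₂ / b ^ 2 + 4 * S ^ 2 / b ^ 4)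
      (f₁ := (A₁ - A₂ + 2 * (B₁ - B₂) / b ^ 2 - 4 * S ^ 2 / b ^ 4) / b ^ 2) fun s hs => ?_
    rw [← hfun s hs]
    have hd : deriv (fourthZ b k m φ) s = 0 := by
      have : fourthZ b k m φ =ᶠ[𝓝 s] fun _ => 1 := by
        filter_upwards [isOpen_Ioo.mem_nhds hs] with t ht
          using h.fourthZ_eq_one hb hm hm1 hk hkb ht
      rw [this.deriv_eq, deriv_const]
    rw [h.fourthZ_eq_one hb hm hm1 hk hkb hs, hd]
    field_simp
    ring

section Derivatives

variable {n : ℕ} {U : Set (Fin n → ℝ)} {x : Fin n → ℝ}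

lemma sum_mul_pd (f : (Fin n → ℝ) → ℝ) (x y : Fin n → ℝ) :
    ∑ k, y k * pd f x k = fderiv ℝ f x y := by
  conv_rhs => rw [pi_eq_sum_univ' y, map_sum]
  refine Finset.sum_congr rfl fun k _ => ?_
  rw [map_smul, smul_eq_mul, pd]

lemma fderiv_betaFn {c : (Fin n → ℝ) → Fin n → ℝ}
    (hc : ∀ i, DifferentiableAt ℝ (fun x => c x i) x) (y : Fin n → ℝ) :
    fderiv ℝ (fun x' => betaFn c x' y) x y = ∑ i, ∑ k, pd (fun x' => c x' i) x k * y i * y k := by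
  unfold betaFn
  rw [fderiv_fun_sum fun i _ => (hc i).mul_const _, _root_.sum_apply]
  refine Finset.sum_congr rfl fun i _ => ?_
  rw [fderiv_mul_const (hc i), _root_.smul_apply, ← sum_mul_pd, smul_eq_mul,
    Finset.mul_sum]
  exact Finset.sum_congr rfl fun k _ => by ring

lemma differentiableAt_betaFn {c : (Fin n → ℝ) → Fin n → ℝ}
    (hc : ∀ i, DifferentiableAt ℝ (fun x => c x i) x) (y : Fin n → ℝ) :
    DifferentiableAt ℝ (fun x' => betaFn c x' y) x := by
  unfold betaFn
  fun_prop

lemma fderiv_sum_sum {a : (Fin n → ℝ) → Matrix (Fin n) (Fin n) ℝ}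
    (ha : ∀ i j, DifferentiableAt ℝ (fun x => a x i j) x) (y : Fin n → ℝ) :
    fderiv ℝ (fun x' => ∑ i, ∑ j, a x' i j * y i * y j) x y
      = ∑ i, ∑ j, ∑ k, pd (fun x' => a x' i j) x k * y i * y j * y k := by
  rw [fderiv_fun_sum fun i _ => by fun_prop, _root_.sum_apply]
  refine Finset.sum_congr rfl fun i _ => ?_
  rw [fderiv_fun_sum fun j _ => by fun_prop, _root_.sum_apply]
  refine Finset.sum_congr rfl fun j _ => ?_
  rw [fderiv_mul_const (by fun_prop), fderiv_mul_const (ha i j), _root_.smul_apply,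
    _root_.smul_apply, ← sum_mul_pd, smul_eq_mul, smul_eq_mul, Finset.mul_sum,
    Finset.mul_sum]
  exact Finset.sum_congr rfl fun k _ => by ring

lemma contDiffOn_pd (hU : IsOpen U) {f : (Fin n → ℝ) → ℝ} (hf : ContDiffOn ℝ (⊤ : ℕ∞) f U)
    (k : Fin n) : ContDiffOn ℝ (⊤ : ℕ∞) (fun x => pd f x k) U :=
  (hf.fderiv_of_isOpen hU (by norm_num)).clm_apply contDiffOn_const

end Derivatives

section Smooth

variable {U : Set (Fin 2 → ℝ)} {a : (Fin 2 → ℝ) → Matrix (Fin 2) (Fin 2) ℝ}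
  {bb : (Fin 2 → ℝ) → Fin 2 → ℝ}

lemma contDiffOn_matrix_inv (ha : ∀ i j, ContDiffOn ℝ (⊤ : ℕ∞) (fun x => a x i j) U)
    (hpos : ∀ x ∈ U, (a x).PosDef) (i j : Fin 2) :
    ContDiffOn ℝ (⊤ : ℕ∞) (fun x => (a x)⁻¹ i j) U := by
  have hdet : ContDiffOn ℝ (⊤ : ℕ∞) (fun x => (a x).det⁻¹) U := by
    refine ContDiffOn.inv ?_ fun x hx => (hpos x hx).det_pos.ne'
    simp only [Matrix.det_fin_two]
    exact ((ha 0 0).mul (ha 1 1)).sub ((ha 0 1).mul (ha 1 0))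
  simp only [Matrix.inv_def, Ring.inverse_eq_inv', Matrix.smul_apply, smul_eq_mul]
  refine hdet.mul ?_
  fin_cases i <;> fin_cases j <;> simp [Matrix.adjugate_fin_two]
  exacts [ha 1 1, (ha 0 1).neg, (ha 1 0).neg, ha 0 0]

lemma contDiffOn_covDeriv (hU : IsOpen U)
    (ha : ∀ i j, ContDiffOn ℝ (⊤ : ℕ∞) (fun x => a x i j) U) (hpos : ∀ x ∈ U, (a x).PosDef)
    (hb : ∀ i, ContDiffOn ℝ (⊤ : ℕ∞) (fun x => bb x i) U) (i j : Fin 2) :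
    ContDiffOn ℝ (⊤ : ℕ∞) (fun x => covDeriv a bb x i j) U := by
  unfold covDeriv christoffel
  have hp := fun i j k => contDiffOn_pd hU (ha i j) k
  exact (contDiffOn_pd hU (hb i) j).sub <| ContDiffOn.sum fun l _ => (hb l).mul <|
    contDiffOn_const.mul <| ContDiffOn.sum fun p _ => (contDiffOn_matrix_inv ha hpos l p).mul
      (((hp i p j).add (hp j p i)).sub (hp i j p))

lemma contDiffOn_sLow (hU : IsOpen U)
    (ha : ∀ i j, ContDiffOn ℝ (⊤ : ℕ∞) (fun x => a x i j) U) (hpos : ∀ x ∈ U, (a x).PosDef)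
    (hb : ∀ i, ContDiffOn ℝ (⊤ : ℕ∞) (fun x => bb x i) U) (j : Fin 2) :
    ContDiffOn ℝ (⊤ : ℕ∞) (fun x => sLow a bb x j) U := by
  unfold sLow bUp sTensor
  have hc := contDiffOn_covDeriv hU ha hpos hb
  exact ContDiffOn.sum fun i _ => (ContDiffOn.sum fun p _ =>
    (contDiffOn_matrix_inv ha hpos i p).mul (hb p)).mul (((hc i j).sub (hc j i)).div_const 2)

end Smooth

section Pointwise

variable {n : ℕ} {a : (Fin n → ℝ) → Matrix (Fin n) (Fin n) ℝ} {bb : (Fin n → ℝ) → Fin n → ℝ}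
  {x : Fin n → ℝ}

lemma sum_mul_mul_pos (hpos : (a x).PosDef) {y : Fin n → ℝ} (hy : y ≠ 0) :
    0 < ∑ i, ∑ j, a x i j * y i * y j := by
  have := hpos.dotProduct_mulVec_pos hy
  simp only [dotProduct, Matrix.mulVec, star_trivial, Finset.mul_sum] at this
  refine this.trans_eq (Finset.sum_congr rfl fun i _ => Finset.sum_congr rfl fun j _ => by ring)

lemma alphaFn_pos (hpos : (a x).PosDef) {y : Fin n → ℝ} (hy : y ≠ 0) : 0 < alphaFn a x y :=
  Real.sqrt_pos.2 (sum_mul_mul_pos hpos hy)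

lemma alphaFn_sq (hpos : (a x).PosDef) (y : Fin n → ℝ) :
    alphaFn a x y ^ 2 = ∑ i, ∑ j, a x i j * y i * y j := by
  rcases eq_or_ne y 0 with rfl | hy
  · simp [alphaFn]
  · exact Real.sq_sqrt (sum_mul_mul_pos hpos hy).le

lemma sum_mul_inv_mul (hpos : (a x).PosDef) (v : Fin n → ℝ) (i : Fin n) :
    ∑ j, a x i j * ∑ l, (a x)⁻¹ j l * v l = v i := by
  have h : a x * (a x)⁻¹ = 1 := Matrix.mul_nonsing_inv _ hpos.det_pos.ne'.isUnit
  change (a x).mulVec ((a x)⁻¹.mulVec v) i = v i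
  rw [Matrix.mulVec_mulVec, h, Matrix.one_mulVec]

lemma inv_symm (hsymm : (a x).IsSymm) (i j : Fin n) : (a x)⁻¹ i j = (a x)⁻¹ j i := by
  have : ((a x)⁻¹).transpose = (a x)⁻¹ := by rw [Matrix.transpose_nonsing_inv, hsymm.eq]
  exact congrFun (congrFun this j) i

lemma sum_mul_bUp (hsymm : (a x).IsSymm) : ∑ i, bb x i * sUp a bb x i = 0 := by
  have h1 : ∑ i, bb x i * sUp a bb x i = ∑ j, bUp a bb x j * sLow a bb x j := by
    simp only [sUp, bUp, Finset.mul_sum, Finset.sum_mul]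
    rw [Finset.sum_comm]
    refine Finset.sum_congr rfl fun j _ => Finset.sum_congr rfl fun i _ => ?_
    rw [inv_symm hsymm i j]; ring
  have h2 : ∑ j, bUp a bb x j * sLow a bb x j = -∑ j, bUp a bb x j * sLow a bb x j := by
    conv_lhs => simp only [sLow, Finset.mul_sum]
    rw [Finset.sum_comm]
    simp only [sLow, Finset.mul_sum, ← Finset.sum_neg_distrib]
    refine Finset.sum_congr rfl fun j _ => Finset.sum_congr rfl fun i _ => ?_
    simp only [sTensor]; ring
  linarith

lemma sum_mul_christoffel (hpos : (a x).PosDef) (p j k : Fin n) :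
    ∑ l, a x p l * christoffel a x l j k = (pd (fun x' => a x' j p) x k
      + pd (fun x' => a x' k p) x j - pd (fun x' => a x' j k) x p) / 2 := by
  have := sum_mul_inv_mul hpos (fun i => pd (fun x' => a x' j i) x k
    + pd (fun x' => a x' k i) x j - pd (fun x' => a x' j k) x i) p
  rw [← this, Finset.sum_div]
  refine Finset.sum_congr rfl fun l _ => ?_
  rw [christoffel]; ring

end Pointwise

/-- The metric data `(α, β)` of a fourth class metric on a plane domain: `‖β‖_α = b` is constant,
`r_{ij} = -(b_i s_j + b_j s_i)/b²` and the geodesics of `α` are governed by the 1-form `ρ`. -/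
structure IsFourthClassData (U : Set (Fin 2 → ℝ)) (a : (Fin 2 → ℝ) → Matrix (Fin 2) (Fin 2) ℝ)
    (bb ρ : (Fin 2 → ℝ) → Fin 2 → ℝ) (b k m : ℝ) : Prop where
  isOpen : IsOpen U
  contDiffOn_metric : ∀ i j, ContDiffOn ℝ (⊤ : ℕ∞) (fun x => a x i j) U
  isSymm : ∀ x ∈ U, (a x).IsSymm
  posDef : ∀ x ∈ U, (a x).PosDef
  contDiffOn_form : ∀ i, ContDiffOn ℝ (⊤ : ℕ∞) (fun x => bb x i) U
  normBeta_eq : ∀ x ∈ U, normBeta a bb x = b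
  rTensor_eq : ∀ x ∈ U, ∀ i j, rTensor a bb x i j
    = -(bb x i * sLow a bb x j + bb x j * sLow a bb x i) / b ^ 2
  contDiffOn_rho : ∀ i, ContDiffOn ℝ (⊤ : ℕ∞) (fun x => ρ x i) U
  spray_eq : ∀ x ∈ U, ∀ y : Fin 2 → ℝ, ∀ i, spray a x y i = (∑ j, ρ x j * y j) * y i
    - (((m - 2) * (alphaFn a x y) ^ 2 + k * (betaFn bb x y) ^ 2) / ((m - 1) * b ^ 2))
      * sUp a bb x i

lemma ContDiffOn.differentiableAt_of_isOpen {n : ℕ} {U : Set (Fin n → ℝ)} {x : Fin n → ℝ}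
    {f : (Fin n → ℝ) → ℝ} (hf : ContDiffOn ℝ (⊤ : ℕ∞) f U) (hU : IsOpen U) (hx : x ∈ U) :
    DifferentiableAt ℝ f x :=
  (hf.contDiffAt (hU.mem_nhds hx)).differentiableAt (by simp)

namespace IsFourthClassData

variable {U : Set (Fin 2 → ℝ)} {a : (Fin 2 → ℝ) → Matrix (Fin 2) (Fin 2) ℝ}
  {bb ρ : (Fin 2 → ℝ) → Fin 2 → ℝ} {b k m : ℝ} {x y : Fin 2 → ℝ}

lemma fderiv_alphaFn_sq (h : IsFourthClassData U a bb ρ b k m) (hx : x ∈ U) (y : Fin 2 → ℝ) :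
    fderiv ℝ (fun x' => ∑ i, ∑ j, a x' i j * y i * y j) x y
      = 4 * (betaFn ρ x y * alphaFn a x y ^ 2
        - ((m - 2) * alphaFn a x y ^ 2 + k * betaFn bb x y ^ 2) / ((m - 1) * b ^ 2)
          * betaFn (sLow a bb) x y) := by
  have hlow : fderiv ℝ (fun x' => ∑ i, ∑ j, a x' i j * y i * y j) x y
      = 4 * ∑ p, y p * ∑ l, a x p l * spray a x y l := by
    rw [fderiv_sum_sum fun i j =>
      (h.contDiffOn_metric i j).differentiableAt_of_isOpen h.isOpen hx]
    have key := sum_mul_christoffel (h.posDef x hx)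
    simp only [Fin.sum_univ_two, spray] at key ⊢
    linear_combination -2 * (y 0 * y 0 * y 0 * key 0 0 0 + y 0 * y 0 * y 1 * key 0 0 1
      + y 0 * y 1 * y 0 * key 0 1 0 + y 0 * y 1 * y 1 * key 0 1 1 + y 1 * y 0 * y 0 * key 1 0 0
      + y 1 * y 0 * y 1 * key 1 0 1 + y 1 * y 1 * y 0 * key 1 1 0 + y 1 * y 1 * y 1 * key 1 1 1)
  have hs := sum_mul_inv_mul (h.posDef x hx) (sLow a bb x)
  rw [hlow]
  simp only [h.spray_eq x hx y]
  generalize ((m - 2) * alphaFn a x y ^ 2 + k * betaFn bb x y ^ 2) / ((m - 1) * b ^ 2) = Q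
  rw [alphaFn_sq (h.posDef x hx)]
  simp only [betaFn, sUp, Fin.sum_univ_two] at hs ⊢
  linear_combination -4 * Q * (y 0 * hs 0 + y 1 * hs 1)

lemma differentiableAt_alphaFn (h : IsFourthClassData U a bb ρ b k m) (hx : x ∈ U) (hy : y ≠ 0) :
    DifferentiableAt ℝ (fun x' => alphaFn a x' y) x := by
  have := fun i j => (h.contDiffOn_metric i j).differentiableAt_of_isOpen h.isOpen hx
  exact DifferentiableAt.sqrt (by fun_prop) (sum_mul_mul_pos (h.posDef x hx) hy).ne'

lemma fderiv_alphaFn (h : IsFourthClassData U a bb ρ b k m) (hx : x ∈ U) (hy : y ≠ 0) :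
    fderiv ℝ (fun x' => alphaFn a x' y) x y
      = 2 * (betaFn ρ x y * alphaFn a x y ^ 2
        - ((m - 2) * alphaFn a x y ^ 2 + k * betaFn bb x y ^ 2) / ((m - 1) * b ^ 2)
          * betaFn (sLow a bb) x y) / alphaFn a x y := by
  have := fun i j => (h.contDiffOn_metric i j).differentiableAt_of_isOpen h.isOpen hx
  have hd := ((show DifferentiableAt ℝ (fun x' => ∑ i, ∑ j, a x' i j * y i * y j) x by
    fun_prop).hasFDerivAt.sqrt (sum_mul_mul_pos (h.posDef x hx) hy).ne').fderiv
  change fderiv ℝ (fun x' => alphaFn a x' y) x = (1 / (2 * alphaFn a x y)) • _ at hd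
  have hα := alphaFn_pos (h.posDef x hx) hy
  rw [hd, _root_.smul_apply, h.fderiv_alphaFn_sq hx, smul_eq_mul]
  field_simp
  ring

lemma differentiableAt_form (h : IsFourthClassData U a bb ρ b k m) (hx : x ∈ U) (y : Fin 2 → ℝ) :
    DifferentiableAt ℝ (fun x' => betaFn bb x' y) x :=
  differentiableAt_betaFn
    (fun i => (h.contDiffOn_form i).differentiableAt_of_isOpen h.isOpen hx) y

lemma fderiv_form (h : IsFourthClassData U a bb ρ b k m) (hx : x ∈ U) (y : Fin 2 → ℝ) :
    fderiv ℝ (fun x' => betaFn bb x' y) x y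
      = 2 * betaFn bb x y * (betaFn ρ x y - betaFn (sLow a bb) x y / b ^ 2) := by
  rw [fderiv_betaFn fun i => (h.contDiffOn_form i).differentiableAt_of_isOpen h.isOpen hx]
  have hpd : ∀ i j, pd (fun x' => bb x' i) x j
      = rTensor a bb x i j + sTensor a bb x i j + ∑ l, bb x l * christoffel a x l i j := by
    intro i j
    rw [rTensor, sTensor, covDeriv, covDeriv]; ring
  have hs : ∀ i j, sTensor a bb x i j = -sTensor a bb x j i := by
    intro i j
    rw [sTensor, sTensor]; ring
  have hsp := h.spray_eq x hx y
  have hbs := sum_mul_bUp (bb := bb) (h.isSymm x hx)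
  generalize ((m - 2) * alphaFn a x y ^ 2 + k * betaFn bb x y ^ 2) / ((m - 1) * b ^ 2) = Q at hsp
  simp only [hpd, h.rTensor_eq x hx]
  simp only [spray, betaFn, Fin.sum_univ_two] at hsp hbs ⊢
  linear_combination 2 * (bb x 0 * hsp 0 + bb x 1 * hsp 1) - 2 * Q * hbs
    + y 0 ^ 2 / 2 * hs 0 0 + y 1 ^ 2 / 2 * hs 1 1 + y 0 * y 1 * hs 0 1

lemma hasFDerivAt_ratio (h : IsFourthClassData U a bb ρ b k m) (hx : x ∈ U) (hy : y ≠ 0) :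
    HasFDerivAt (fun x' => betaFn bb x' y / alphaFn a x' y)
      (betaFn bb x y • -(alphaFn a x y ^ 2)⁻¹ • fderiv ℝ (fun x' => alphaFn a x' y) x
        + (alphaFn a x y)⁻¹ • fderiv ℝ (fun x' => betaFn bb x' y) x) x := by
  simp only [div_eq_mul_inv]
  exact (h.differentiableAt_form hx y).hasFDerivAt.mul
    ((hasDerivAt_inv (alphaFn_pos (h.posDef x hx) hy).ne').comp_hasFDerivAt x
      (h.differentiableAt_alphaFn hx hy).hasFDerivAt)

lemma fderiv_ratio (h : IsFourthClassData U a bb ρ b k m) (hb : 0 < b) (hm1 : m ≠ 1) (hx : x ∈ U)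
    (hy : y ≠ 0) :
    fderiv ℝ (fun x' => betaFn bb x' y / alphaFn a x' y) x y
      = -2 * (betaFn bb x y / alphaFn a x y) * betaFn (sLow a bb) x y
        * (1 - k * (betaFn bb x y / alphaFn a x y) ^ 2) / ((m - 1) * b ^ 2) := by
  have hα := alphaFn_pos (h.posDef x hx) hy
  have hM : m - 1 ≠ 0 := sub_ne_zero.2 hm1
  rw [(h.hasFDerivAt_ratio hx hy).fderiv]
  simp only [_root_.smul_apply, _root_.add_apply, smul_eq_mul, h.fderiv_form hx,
    h.fderiv_alphaFn hx hy]
  field_simp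
  ring

lemma differentiableAt_sLow (h : IsFourthClassData U a bb ρ b k m) (hx : x ∈ U) (i : Fin 2) :
    DifferentiableAt ℝ (fun x' => sLow a bb x' i) x :=
  (contDiffOn_sLow h.isOpen h.contDiffOn_metric h.posDef h.contDiffOn_form
    i).differentiableAt_of_isOpen h.isOpen hx

lemma differentiableAt_rho (h : IsFourthClassData U a bb ρ b k m) (hx : x ∈ U) (i : Fin 2) :
    DifferentiableAt ℝ (fun x' => ρ x' i) x :=
  (h.contDiffOn_rho i).differentiableAt_of_isOpen h.isOpen hx

/-- The pairs `(x, y)` with `0 < β/α < b` form an open set in `x`. -/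
lemma eventually_ratio_mem (h : IsFourthClassData U a bb ρ b k m) (hx : x ∈ U) (hy : y ≠ 0)
    (hs : betaFn bb x y / alphaFn a x y ∈ Set.Ioo 0 b) :
    ∀ᶠ x' in 𝓝 x, x' ∈ U ∧ betaFn bb x' y / alphaFn a x' y ∈ Set.Ioo 0 b :=
  (h.isOpen.eventually_mem hx).and <|
    (h.hasFDerivAt_ratio hx hy).continuousAt.eventually_mem (isOpen_Ioo.mem_nhds hs)

lemma form_pos (h : IsFourthClassData U a bb ρ b k m) (hx : x ∈ U) (hy : y ≠ 0)
    (hs : betaFn bb x y / alphaFn a x y ∈ Set.Ioo 0 b) : 0 < betaFn bb x y :=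
  (div_pos_iff_of_pos_right (alphaFn_pos (h.posDef x hx) hy)).1 hs.1

lemma projFactor_eq (h : IsFourthClassData U a bb ρ b k m) {φ : ℝ → ℝ}
    (hφ : IsFourthClass b k m φ) (hb : 0 < b) (hm1 : m ≠ 1)
    (hk : ∀ s ∈ Set.Ioo 0 b, 0 < 1 - k * s ^ 2) {F : (Fin 2 → ℝ) → (Fin 2 → ℝ) → ℝ}
    (hF : ∀ pt ∈ Dom U bb,
      F pt.1 pt.2 = alphaFn a pt.1 pt.2 * φ (betaFn bb pt.1 pt.2 / alphaFn a pt.1 pt.2))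
    (hx : x ∈ U) (hy : y ≠ 0) (hs : betaFn bb x y / alphaFn a x y ∈ Set.Ioo 0 b) :
    projFactor F x y = betaFn ρ x y - betaFn (sLow a bb) x y
      * (1 + fourthZ b k m φ (betaFn bb x y / alphaFn a x y)) / b ^ 2 := by
  have hFev : (fun x' => F x' y)
      =ᶠ[𝓝 x] fun x' => alphaFn a x' y * φ (betaFn bb x' y / alphaFn a x' y) := by
    filter_upwards [h.eventually_ratio_mem hx hy hs] with x' hx'
    exact hF (x', y) ⟨hx'.1, hy, h.form_pos hx'.1 hy hx'.2⟩
  have hα := alphaFn_pos (h.posDef x hx) hy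
  have hM : m - 1 ≠ 0 := sub_ne_zero.2 hm1
  have hd := ((h.differentiableAt_alphaFn hx hy).hasFDerivAt.mul
    ((hφ.hasDerivAt_eq hm1 hk hs).comp_hasFDerivAt x
      (h.hasFDerivAt_ratio hx hy).differentiableAt.hasFDerivAt)).congr_of_eventuallyEq hFev
  rw [projFactor, sum_mul_pd, hd.fderiv, hFev.eq_of_nhds]
  simp only [_root_.smul_apply, _root_.add_apply, smul_eq_mul, h.fderiv_ratio hb hm1 hx hy,
    h.fderiv_alphaFn hx hy, Function.comp_apply]
  have hφ0 := hφ.pos _ hs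
  have hw := hk _ hs
  have hβ : betaFn bb x y = betaFn bb x y / alphaFn a x y * alphaFn a x y := by field_simp
  have hs0 := hs.1
  generalize betaFn bb x y / alphaFn a x y = s at *
  rw [hβ]
  generalize hwd : 1 - k * s ^ 2 = w at *
  have hks : k = (1 - w) / s ^ 2 := by rw [← hwd]; field_simp; ring
  generalize fourthZ b k m φ s = z
  rw [hks]
  field_simp
  ring

lemma functional_equation (h : IsFourthClassData U a bb ρ b k m) {φ : ℝ → ℝ}
    (hφ : IsFourthClass b k m φ) (hb : 0 < b) (hm : 0 < m) (hm1 : m ≠ 1)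
    (hk : ∀ s ∈ Set.Ioo 0 b, 0 < 1 - k * s ^ 2) {F : (Fin 2 → ℝ) → (Fin 2 → ℝ) → ℝ} {K : ℝ}
    (hF : ∀ pt ∈ Dom U bb,
      F pt.1 pt.2 = alphaFn a pt.1 pt.2 * φ (betaFn bb pt.1 pt.2 / alphaFn a pt.1 pt.2))
    (hK : ConstFlagCurv U bb F K) (hx : x ∈ U) (hα : alphaFn a x y = 1) {s : ℝ}
    (hβ : betaFn bb x y = s) (hs : s ∈ Set.Ioo 0 b) :
    betaFn ρ x y ^ 2 - fderiv ℝ (fun x' => betaFn ρ x' y) x y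
      + (1 + fourthZ b k m φ s) / b ^ 2 * (fderiv ℝ (fun x' => betaFn (sLow a bb) x' y) x y
        - 2 * betaFn ρ x y * betaFn (sLow a bb) x y)
      + betaFn (sLow a bb) x y ^ 2 / b ^ 4 * ((1 + fourthZ b k m φ s) ^ 2
          - 2 * s * deriv (fourthZ b k m φ) s * (1 - k * s ^ 2) / (m - 1))
      = K * φ s ^ 2 := by
  have hM : m - 1 ≠ 0 := sub_ne_zero.2 hm1
  have hy : y ≠ 0 := by
    rintro rfl
    simp [alphaFn] at hα
  have hsr : betaFn bb x y / alphaFn a x y = s := by rw [hα, hβ, div_one]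
  have hs' := hs
  rw [← hsr] at hs'
  have hP : (fun x' => projFactor F x' y) =ᶠ[𝓝 x] fun x' => betaFn ρ x' y
      - betaFn (sLow a bb) x' y
        * (1 + fourthZ b k m φ (betaFn bb x' y / alphaFn a x' y)) * (b ^ 2)⁻¹ := by
    filter_upwards [h.eventually_ratio_mem hx hy hs'] with x' hx'
    exact h.projFactor_eq hφ hb hm1 hk hF hx'.1 hy hx'.2
  have hz : HasDerivAt (fourthZ b k m φ) (deriv (fourthZ b k m φ) s)
      (betaFn bb x y / alphaFn a x y) := by
    rw [hsr]
    exact (hφ.hasDerivAt_fourthZ hm hm1 hk hs).differentiableAt.hasDerivAt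
  have hd := ((differentiableAt_betaFn (h.differentiableAt_rho hx) y).hasFDerivAt.sub
    (((differentiableAt_betaFn (h.differentiableAt_sLow hx) y).hasFDerivAt.mul
      ((hz.comp_hasFDerivAt x
        (h.hasFDerivAt_ratio hx hy).differentiableAt.hasFDerivAt).const_add 1)).mul_const
          (b ^ 2)⁻¹)).congr_of_eventuallyEq hP
  have hc := hK (x, y) ⟨hx, hy, by rw [hβ]; exact hs.1⟩
  simp only [sum_mul_pd] at hc
  rw [hF (x, y) ⟨hx, hy, by rw [hβ]; exact hs.1⟩] at hc
  simp only [hd.fderiv, hP.eq_of_nhds] at hc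
  simp only [_root_.smul_apply, _root_.add_apply, _root_.sub_apply, smul_eq_mul,
    h.fderiv_ratio hb hm1 hx hy, hα, hβ, div_one, Function.comp_apply, one_mul] at hc
  rw [← hc]
  field_simp
  ring

lemma sum_form_mul_bUp (h : IsFourthClassData U a bb ρ b k m) (hb : 0 < b) (hx : x ∈ U) :
    ∑ i, bb x i * bUp a bb x i = b ^ 2 := by
  have h1 := h.normBeta_eq x hx
  have h2 : 0 < ∑ i, ∑ j, (a x)⁻¹ i j * bb x i * bb x j := by
    rw [normBeta] at h1
    exact Real.sqrt_pos.1 (by rw [h1]; exact hb)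
  rw [← h1, normBeta, Real.sq_sqrt h2.le]
  simp only [bUp, Finset.mul_sum]
  exact Finset.sum_congr rfl fun i _ => Finset.sum_congr rfl fun j _ => by ring

lemma exists_sLow_ne_zero (h : IsFourthClassData U a bb ρ b k m) (hb : 0 < b)
    (hpar : ¬ ∀ x ∈ U, ∀ i j, covDeriv a bb x i j = 0) : ∃ x ∈ U, sLow a bb x ≠ 0 := by
  contrapose! hpar
  intro x hx
  have hl := hpar x hx
  have hr := h.rTensor_eq x hx
  have hb2 := h.sum_form_mul_bUp hb hx
  have hl0 := congrFun hl 0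
  have hl1 := congrFun hl 1
  simp only [hl, Pi.zero_apply, mul_zero, add_zero, neg_zero, zero_div, rTensor] at hr
  simp only [sLow, sTensor, Fin.sum_univ_two, Pi.zero_apply] at hl0 hl1 hb2
  have key : covDeriv a bb x 0 1 - covDeriv a bb x 1 0 = 0 := by
    have : b ^ 2 * (covDeriv a bb x 0 1 - covDeriv a bb x 1 0) = 0 := by
      linear_combination -(covDeriv a bb x 0 1 - covDeriv a bb x 1 0) * hb2
        + 2 * bb x 0 * hl1 - 2 * bb x 1 * hl0
    simpa [hb.ne'] using this
  have h00 := hr 0 0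
  have h01 := hr 0 1
  have h11 := hr 1 1
  intro i j
  fin_cases i <;> fin_cases j <;> simp only [Fin.zero_eta, Fin.mk_one] <;> linarith

end IsFourthClassData

/-- The sum of a quadratic form over `p v + q w` and `p v - q w` has no mixed term. -/
lemma fderiv_betaFn_add_sub {n : ℕ} {c : (Fin n → ℝ) → Fin n → ℝ} {x : Fin n → ℝ}
    (hc : ∀ i, DifferentiableAt ℝ (fun x => c x i) x) (p q : ℝ) (v w : Fin n → ℝ) :
    fderiv ℝ (fun x' => betaFn c x' (p • v + q • w)) x (p • v + q • w)
      + fderiv ℝ (fun x' => betaFn c x' (p • v + (-q) • w)) x (p • v + (-q) • w)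
      = 2 * (p ^ 2 * fderiv ℝ (fun x' => betaFn c x' v) x v
        + q ^ 2 * fderiv ℝ (fun x' => betaFn c x' w) x w) := by
  simp only [fderiv_betaFn hc, Finset.mul_sum, ← Finset.sum_add_distrib]
  refine Finset.sum_congr rfl fun i _ => Finset.sum_congr rfl fun j _ => ?_
  simp only [Pi.add_apply, Pi.smul_apply, smul_eq_mul]
  ring

lemma betaFn_combination {n : ℕ} (c : (Fin n → ℝ) → Fin n → ℝ) (x v w : Fin n → ℝ) (p q : ℝ) :
    betaFn c x (p • v + q • w) = p * betaFn c x v + q * betaFn c x w := by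
  simp only [betaFn, Finset.mul_sum, ← Finset.sum_add_distrib]
  refine Finset.sum_congr rfl fun i _ => ?_
  simp only [Pi.add_apply, Pi.smul_apply, smul_eq_mul]
  ring

namespace IsFourthClassData

variable {U : Set (Fin 2 → ℝ)} {a : (Fin 2 → ℝ) → Matrix (Fin 2) (Fin 2) ℝ}
  {bb ρ : (Fin 2 → ℝ) → Fin 2 → ℝ} {b k m : ℝ} {x : Fin 2 → ℝ}

lemma betaFn_sLow_bUp (h : IsFourthClassData U a bb ρ b k m) (hx : x ∈ U) :
    betaFn (sLow a bb) x (bUp a bb x) = 0 := by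
  rw [← sum_mul_bUp (bb := bb) (h.isSymm x hx)]
  simp only [betaFn, bUp, sUp, Fin.sum_univ_two]
  rw [inv_symm (h.isSymm x hx) 1 0]
  ring

lemma sum_mul_sUp (h : IsFourthClassData U a bb ρ b k m) (hx : x ∈ U) (i : Fin 2) :
    ∑ j, a x i j * sUp a bb x j = sLow a bb x i :=
  sum_mul_inv_mul (h.posDef x hx) (sLow a bb x) i

lemma betaFn_sLow_sUp_pos (h : IsFourthClassData U a bb ρ b k m) (hx : x ∈ U)
    (hl : sLow a bb x ≠ 0) : 0 < betaFn (sLow a bb) x (sUp a bb x) := by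
  have hs := h.sum_mul_sUp hx
  have hy : sUp a bb x ≠ 0 := by
    intro h0
    refine hl (funext fun i => ?_)
    simpa [h0] using (hs i).symm
  refine (sum_mul_mul_pos (h.posDef x hx) hy).trans_eq ?_
  refine Finset.sum_congr rfl fun i _ => ?_
  rw [← hs i, Finset.sum_mul]
  exact Finset.sum_congr rfl fun j _ => by ring

lemma alphaFn_combination (h : IsFourthClassData U a bb ρ b k m) (hb : 0 < b) (hx : x ∈ U)
    (p q : ℝ) : alphaFn a x (p • bUp a bb x + q • sUp a bb x)
      = √(p ^ 2 * b ^ 2 + q ^ 2 * betaFn (sLow a bb) x (sUp a bb x)) := by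
  have hs := h.sum_mul_sUp hx
  have hv : ∀ i, ∑ j, a x i j * bUp a bb x j = bb x i := sum_mul_inv_mul (h.posDef x hx) (bb x)
  have h1 := h.sum_form_mul_bUp hb hx
  have h2 := sum_mul_bUp (bb := bb) (h.isSymm x hx)
  have h3 := h.betaFn_sLow_bUp hx
  rw [alphaFn]
  congr 1
  simp only [betaFn, Fin.sum_univ_two, Pi.add_apply, Pi.smul_apply, smul_eq_mul] at hs hv h1 h2 h3 ⊢
  generalize bUp a bb x = v at hv h1 h3 ⊢
  generalize sUp a bb x = w at hs h2 ⊢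
  linear_combination (p * v 0 + q * w 0) * (p * hv 0 + q * hs 0)
    + (p * v 1 + q * w 1) * (p * hv 1 + q * hs 1) + p ^ 2 * h1 + p * q * h2 + p * q * h3

/-- Averaging the curvature equation over two `α`-unit vectors with the same value of `β` yields
a functional equation for `φ` alone. -/
lemma exists_functional_equation (h : IsFourthClassData U a bb ρ b k m) {φ : ℝ → ℝ}
    (hφ : IsFourthClass b k m φ) (hb : 0 < b) (hm : 0 < m) (hm1 : m ≠ 1)
    (hk : ∀ s ∈ Set.Ioo 0 b, 0 < 1 - k * s ^ 2) {F : (Fin 2 → ℝ) → (Fin 2 → ℝ) → ℝ} {K : ℝ}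
    (hF : ∀ pt ∈ Dom U bb,
      F pt.1 pt.2 = alphaFn a pt.1 pt.2 * φ (betaFn bb pt.1 pt.2 / alphaFn a pt.1 pt.2))
    (hK : ConstFlagCurv U bb F K) (hx : x ∈ U) (hl : sLow a bb x ≠ 0) :
    ∃ A₁ A₂ B₁ B₂ S : ℝ, 0 < S ∧ ∀ s ∈ Set.Ioo 0 b,
      A₁ * (s ^ 2 / b ^ 2) + A₂ * (1 - s ^ 2 / b ^ 2)
        + (1 + fourthZ b k m φ s) / b ^ 2 * (B₁ * (s ^ 2 / b ^ 2) + B₂ * (1 - s ^ 2 / b ^ 2))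
        + S ^ 2 / b ^ 4 * (1 - s ^ 2 / b ^ 2) * ((1 + fourthZ b k m φ s) ^ 2
          - 2 * s * deriv (fourthZ b k m φ) s * (1 - k * s ^ 2) / (m - 1))
      = K * φ s ^ 2 := by
  have hS2 := h.betaFn_sLow_sUp_pos hx hl
  have hα := h.alphaFn_combination hb hx
  have hvβ : betaFn bb x (bUp a bb x) = b ^ 2 := h.sum_form_mul_bUp hb hx
  have hwβ : betaFn bb x (sUp a bb x) = 0 := sum_mul_bUp (h.isSymm x hx)
  have hvs := h.betaFn_sLow_bUp hx
  have hA := fderiv_betaFn_add_sub (h.differentiableAt_rho hx)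
  have hB := fderiv_betaFn_add_sub (h.differentiableAt_sLow hx)
  generalize bUp a bb x = v at *
  generalize sUp a bb x = w at *
  obtain ⟨S, hS, hSS⟩ : ∃ S, 0 < S ∧ S ^ 2 = betaFn (sLow a bb) x w :=
    ⟨_, Real.sqrt_pos.2 hS2, Real.sq_sqrt hS2.le⟩
  refine ⟨(betaFn ρ x v ^ 2 - fderiv ℝ (fun x' => betaFn ρ x' v) x v) / b ^ 2,
    (betaFn ρ x w ^ 2 - fderiv ℝ (fun x' => betaFn ρ x' w) x w) / S ^ 2,
    fderiv ℝ (fun x' => betaFn (sLow a bb) x' v) x v / b ^ 2,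
    fderiv ℝ (fun x' => betaFn (sLow a bb) x' w) x w / S ^ 2 - 2 * betaFn ρ x w,
    S, hS, fun s hs => ?_⟩
  have hu := one_sub_sq_div_sq_pos hs
  have hq : ∀ q : ℝ, q ^ 2 = (1 - s ^ 2 / b ^ 2) / S ^ 2 → _ := fun q hq =>
    h.functional_equation hφ hb hm hm1 hk hF hK hx (y := (s / b ^ 2) • v + q • w) (s := s)
      (by rw [hα, hq, ← hSS, Real.sqrt_eq_one]; field_simp; ring)
      (by rw [betaFn_combination, hvβ, hwβ]; field_simp; ring) hs
  obtain ⟨q, hqq⟩ : ∃ q : ℝ, q ^ 2 = (1 - s ^ 2 / b ^ 2) / S ^ 2 :=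
    ⟨_, Real.sq_sqrt (by positivity)⟩
  have e₁ := hq q hqq
  have e₂ := hq (-q) (by rw [neg_sq, hqq])
  have hA := hA (s / b ^ 2) q v w
  have hB := hB (s / b ^ 2) q v w
  simp only [betaFn_combination, hvs, ← hSS] at e₁ e₂ hA hB
  have hsb : s ^ 2 / b ^ 2 = (s / b ^ 2) ^ 2 * b ^ 2 := by field_simp
  have huq : 1 - s ^ 2 / b ^ 2 = q ^ 2 * S ^ 2 := by rw [hqq]; field_simp
  have g₁ : ∀ X Y : ℝ, X / b ^ 2 * (Y * b ^ 2) = X * Y := fun X Y => by field_simp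
  have g₂ : ∀ X Y : ℝ, X / S ^ 2 * (Y * S ^ 2) = X * Y := fun X Y => by field_simp
  rw [huq, hsb, sub_mul (_ / S ^ 2)]
  simp only [g₁, g₂]
  linear_combination (e₁ + e₂) / 2 + hA / 2 - (1 + fourthZ b k m φ s) / b ^ 2 * hB / 2

end IsFourthClassData

/-- the fourth class in dimension 2: with `‖β‖_α ≡ b` constant,
`β` not parallel, `φ(s) = m·b²·√(b²−s²)·∫₀ˢ (b²−t²)^{-3/2}(t/√(1−kt²))^{m−1} dt`,
the extra structure equations on `r_{ij}` and `Gⁱ_α`, and `F = α·φ(β/α)`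
projectively flat of constant flag curvature `K`, one of three cases holds. -/
theorem fourth_class_dim2_classification
    (U : Set (Fin 2 → ℝ)) (hU : IsOpen U)
    (a : (Fin 2 → ℝ) → Matrix (Fin 2) (Fin 2) ℝ)
    (bb : (Fin 2 → ℝ) → Fin 2 → ℝ)
    (ha_smooth : ∀ i j, ContDiffOn ℝ (⊤ : ℕ∞) (fun x => a x i j) U)
    (ha_symm : ∀ x ∈ U, (a x).IsSymm)
    (ha_pos : ∀ x ∈ U, (a x).PosDef)
    (hb_smooth : ∀ i, ContDiffOn ℝ (⊤ : ℕ∞) (fun x => bb x i) U)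
    (hb_ne : ∀ x ∈ U, bb x ≠ 0)
    (b : ℝ) (hb : 0 < b)
    (hconstb : ∀ x ∈ U, normBeta a bb x = b)
    (hnotpar : ¬ (∀ x ∈ U, ∀ i j, covDeriv a bb x i j = 0))
    (m k : ℝ) (hm : 0 < m) (hm1 : m ≠ 1)
    (hk : ∀ t ∈ Set.Ico (0 : ℝ) b, 0 < 1 - k * t ^ 2)
    (φ : ℝ → ℝ)
    (hφ : ∀ s ∈ Set.Ioo (0 : ℝ) b, φ s = m * b ^ 2 * Real.sqrt (b ^ 2 - s ^ 2) *
      ∫ t in (0 : ℝ)..s,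
        (b ^ 2 - t ^ 2) ^ (-(3 / 2 : ℝ)) * (t / Real.sqrt (1 - k * t ^ 2)) ^ (m - 1))
    (F : (Fin 2 → ℝ) → (Fin 2 → ℝ) → ℝ)
    (hF : ∀ pt ∈ Dom U bb,
      F pt.1 pt.2 = alphaFn a pt.1 pt.2 * φ (betaFn bb pt.1 pt.2 / alphaFn a pt.1 pt.2))
    (hFpos : ∀ pt ∈ Dom U bb, 0 < F pt.1 pt.2)
    (hr : ∀ x ∈ U, ∀ i j, rTensor a bb x i j
      = -(bb x i * sLow a bb x j + bb x j * sLow a bb x i) / b ^ 2)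
    (hG : ∃ ρ : (Fin 2 → ℝ) → Fin 2 → ℝ,
      (∀ i, ContDiffOn ℝ (⊤ : ℕ∞) (fun x => ρ x i) U) ∧
      ∀ x ∈ U, ∀ y : Fin 2 → ℝ, ∀ i,
        spray a x y i = (∑ j, ρ x j * y j) * y i
          - (((m - 2) * (alphaFn a x y) ^ 2 + k * (betaFn bb x y) ^ 2)
              / ((m - 1) * b ^ 2)) * sUp a bb x i)
    (K : ℝ)
    (hPF : HamelProjFlat U bb F)
    (hK : ConstFlagCurv U bb F K) :
    ((∀ s ∈ Set.Ioo (0 : ℝ) b,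
        φ s = s ^ m * (1 - s ^ 2 / b ^ 2) ^ ((1 - m) / 2)) ∧ K = 0)
    ∨ (k * b ^ 2 ≠ 1 ∧
        ∀ s ∈ Set.Ioo (0 : ℝ) b,
          φ s = (2 * b / (1 - k * b ^ 2))
            * (b * Real.sqrt (1 - k * s ^ 2) - Real.sqrt (b ^ 2 - s ^ 2)))
    ∨ (k * b ^ 2 ≠ 1 ∧
        (∀ s ∈ Set.Ioo (0 : ℝ) b,
          φ s = (4 * b ^ 2 / (1 - k * b ^ 2) ^ 2)
            * (b * Real.sqrt (1 - k * s ^ 2) - Real.sqrt (b ^ 2 - s ^ 2)) ^ 2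
            / Real.sqrt (1 - k * s ^ 2)) ∧ K = 0) := by
  obtain ⟨ρ, hρ, hG⟩ := hG
  have h : IsFourthClassData U a bb ρ b k m :=
    ⟨hU, ha_smooth, ha_symm, ha_pos, hb_smooth, hconstb, hr, hρ, hG⟩
  have hφ := isFourthClass_of_integral hb hm hk hφ
  have hk' : ∀ s ∈ Set.Ioo 0 b, 0 < 1 - k * s ^ 2 := fun s hs => hk s ⟨hs.1.le, hs.2⟩
  obtain ⟨x, hx, hl⟩ := h.exists_sLow_ne_zero hb hnotpar
  obtain ⟨A₁, A₂, B₁, B₂, S, hS, hfun⟩ := h.exists_functional_equation hφ hb hm hm1 hk' hF hK hx hl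
  exact hφ.classification hb hm hm1 hk' hS hfun
end
end

section
/- Let a₁, k, m be real constants and let s > 0 satisfy 1 + k·s² > 0. Then the function φ(s) := a₁·s + s^m·(1 + k·s²)^{(1−m)/2} (real powers) satisfies the identity s²·(1 + k·s²)·φ''(s) = (k·s² − m)·(φ(s) − s·φ'(s)). -/
noncomputable section

open Real

/-- `φ(s) = a₁·s + sᵐ·(1 + k·s²)^((1−m)/2)` (real powers). -/
def phi8 (a₁ k m : ℝ) (s : ℝ) : ℝ :=
  a₁ * s + s ^ m * (1 + k * s ^ 2) ^ ((1 - m) / 2)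

/-- Logarithmic-derivative form of the derivative of the nonlinear part of `phi8`. -/
theorem hasDerivAt_rpow_mul_one_add_rpow (k m x : ℝ) (hx : 0 < x) (hkx : 0 < 1 + k * x ^ 2) :
    HasDerivAt (fun s : ℝ => s ^ m * (1 + k * s ^ 2) ^ ((1 - m) / 2))
      (x ^ m * (1 + k * x ^ 2) ^ ((1 - m) / 2) *
        ((m + k * x ^ 2) / (x * (1 + k * x ^ 2)))) x := by
  have hu : HasDerivAt (fun s : ℝ => 1 + k * s ^ 2) (k * (2 * x)) x := by
    simpa using ((hasDerivAt_pow 2 x).const_mul k).const_add 1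
  have h := (Real.hasDerivAt_rpow_const (p := m) (Or.inl hx.ne')).mul
    (hu.rpow_const (p := (1 - m) / 2) (Or.inl hkx.ne'))
  refine h.congr_deriv ?_
  rw [Real.rpow_sub_one hx.ne', Real.rpow_sub_one hkx.ne']
  have hu0 : 1 + x ^ 2 * k ≠ 0 := by rw [mul_comm]; exact hkx.ne'
  generalize (1 + k * x ^ 2) ^ ((1 - m) / 2) = g
  field_simp
  ring

theorem hasDerivAt_phi8 (a₁ k m x : ℝ) (hx : 0 < x) (hkx : 0 < 1 + k * x ^ 2) :
    HasDerivAt (phi8 a₁ k m)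
      (a₁ + x ^ m * (1 + k * x ^ 2) ^ ((1 - m) / 2) *
        ((m + k * x ^ 2) / (x * (1 + k * x ^ 2)))) x := by
  have h := ((hasDerivAt_id x).const_mul a₁).add (hasDerivAt_rpow_mul_one_add_rpow k m x hx hkx)
  rw [mul_one] at h
  exact h

/-- `φ(s) = a₁·s + sᵐ(1+ks²)^((1−m)/2)` satisfies
`s²(1+ks²)φ'' = (ks² − m)(φ − sφ')` for `s > 0` with `1 + ks² > 0`. -/
theorem phi8_ode (a₁ k m s : ℝ) (hs : 0 < s) (hks : 0 < 1 + k * s ^ 2) :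
    s ^ 2 * (1 + k * s ^ 2) * deriv (deriv (phi8 a₁ k m)) s
      = (k * s ^ 2 - m) * (phi8 a₁ k m s - s * deriv (phi8 a₁ k m) s) := by
  have hopen : ∀ᶠ x in nhds s, 0 < x ∧ 0 < 1 + k * x ^ 2 := by
    have hc : ContinuousAt (fun x : ℝ => 1 + k * x ^ 2) s := by fun_prop
    exact (eventually_gt_nhds hs).and (hc.eventually (eventually_gt_nhds hks))
  have hderiv : deriv (phi8 a₁ k m) =ᶠ[nhds s] fun x =>
      a₁ + x ^ m * (1 + k * x ^ 2) ^ ((1 - m) / 2) *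
        ((m + k * x ^ 2) / (x * (1 + k * x ^ 2))) := by
    filter_upwards [hopen] with x hx
    exact (hasDerivAt_phi8 a₁ k m x hx.1 hx.2).deriv
  have hsq : HasDerivAt (fun x : ℝ => k * x ^ 2) (k * (2 * s)) s := by
    simpa using (hasDerivAt_pow 2 s).const_mul k
  have hquot := (hsq.const_add m).fun_div ((hasDerivAt_id' s).fun_mul (hsq.const_add 1))
    (mul_pos hs hks).ne'
  have hsecond :=
    (((hasDerivAt_rpow_mul_one_add_rpow k m s hs hks).fun_mul hquot).const_add a₁).deriv
  have hu0 : 1 + s ^ 2 * k ≠ 0 := by rw [mul_comm]; exact hks.ne'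
  rw [hderiv.deriv_eq, hsecond, (hasDerivAt_phi8 a₁ k m s hs hks).deriv, phi8]
  generalize s ^ m * (1 + k * s ^ 2) ^ ((1 - m) / 2) = g
  field_simp
  ring
end
end

section
/- Let b > 0 and k be real constants with k·b² ≠ 1, and let s ∈ (0, b) satisfy 1 − k·s² > 0. Then the function φ(s) := (2b/(1 − k·b²))·(b·√(1 − k·s²) − √(b² − s²)) satisfies the identity s·(1 − k·s²)·(φ(s) − s·φ'(s) + (b² − s²)·φ''(s)) = s·φ(s) + (b² − s²)·φ'(s). -/
noncomputable section

open Real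

/-- `φ(s) = (2b/(1 − kb²))·(b√(1 − ks²) − √(b² − s²))`. -/
def phi9 (b k : ℝ) (s : ℝ) : ℝ :=
  (2 * b / (1 - k * b ^ 2)) * (b * Real.sqrt (1 - k * s ^ 2) - Real.sqrt (b ^ 2 - s ^ 2))

theorem hasDerivAt_sqrt_sub_mul_sq {c d x : ℝ} (h : 0 < c - d * x ^ 2) :
    HasDerivAt (fun t => √(c - d * t ^ 2)) (-(d * x) / √(c - d * x ^ 2)) x := by
  have h₁ : HasDerivAt (fun t : ℝ => c - d * t ^ 2) (-(d * (2 * x))) x := by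
    simpa using ((hasDerivAt_pow 2 x).const_mul d).const_sub c
  have h₂ := h₁.sqrt h.ne'
  have h₃ : √(c - d * x ^ 2) ≠ 0 := (Real.sqrt_pos.2 h).ne'
  convert h₂ using 1
  field_simp

theorem hasDerivAt_neg_mul_div_sqrt_sub_mul_sq {c d x : ℝ} (h : 0 < c - d * x ^ 2) :
    HasDerivAt (fun t => -(d * t) / √(c - d * t ^ 2)) (-(c * d) / √(c - d * x ^ 2) ^ 3) x := by
  have h₁ : HasDerivAt (fun t : ℝ => -(d * t)) (-d) x := by
    simpa using (hasDerivAt_id x).const_mul (-d)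
  have h₃ : √(c - d * x ^ 2) ≠ 0 := (Real.sqrt_pos.2 h).ne'
  have hsq : √(c - d * x ^ 2) ^ 2 = c - d * x ^ 2 := Real.sq_sqrt h.le
  refine (h₁.fun_div (hasDerivAt_sqrt_sub_mul_sq h) h₃).congr_deriv ?_
  field_simp
  linear_combination -d * hsq

theorem hasDerivAt_phi9 {b k x : ℝ} (hb : 0 < b ^ 2 - x ^ 2) (hk : 0 < 1 - k * x ^ 2) :
    HasDerivAt (phi9 b k) ((2 * b / (1 - k * b ^ 2)) *
      (b * (-(k * x) / √(1 - k * x ^ 2)) - -(1 * x) / √(b ^ 2 - 1 * x ^ 2))) x := by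
  have hB := hasDerivAt_sqrt_sub_mul_sq (c := b ^ 2) (d := 1) (x := x) (by simpa using hb)
  have hφ := (((hasDerivAt_sqrt_sub_mul_sq hk).const_mul b).fun_sub hB).const_mul
    (2 * b / (1 - k * b ^ 2))
  refine hφ.congr_of_eventuallyEq (.of_forall fun t => ?_)
  simp [phi9]

theorem deriv_deriv_phi9 {b k x : ℝ} (hb : 0 < b ^ 2 - x ^ 2) (hk : 0 < 1 - k * x ^ 2) :
    deriv (deriv (phi9 b k)) x = (2 * b / (1 - k * b ^ 2)) *
      (b * (-(1 * k) / √(1 - k * x ^ 2) ^ 3) -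
        -(b ^ 2 * 1) / √(b ^ 2 - 1 * x ^ 2) ^ 3) := by
  have hB := hasDerivAt_neg_mul_div_sqrt_sub_mul_sq (c := b ^ 2) (d := 1) (x := x)
    (by simpa using hb)
  have hφ := (((hasDerivAt_neg_mul_div_sqrt_sub_mul_sq hk).const_mul b).sub hB).const_mul
    (2 * b / (1 - k * b ^ 2))
  refine (hφ.congr_of_eventuallyEq ?_).deriv
  have hcb : ContinuousAt (fun t : ℝ => b ^ 2 - t ^ 2) x := by fun_prop
  have hck : ContinuousAt (fun t : ℝ => 1 - k * t ^ 2) x := by fun_prop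
  filter_upwards [hcb.eventually (lt_mem_nhds hb), hck.eventually (lt_mem_nhds hk)] with t h₁ h₂
  exact (hasDerivAt_phi9 h₁ h₂).deriv

/-- `φ(s) = (2b/(1−kb²))(b√(1−ks²) − √(b²−s²))` satisfies the
`m = 2` classifying ODE in cross-multiplied form. -/
theorem phi9_ode (b k s : ℝ) (hb : 0 < b) (hk : k * b ^ 2 ≠ 1)
    (hs : s ∈ Set.Ioo (0 : ℝ) b) (hks : 0 < 1 - k * s ^ 2) :
    s * (1 - k * s ^ 2) *
        (phi9 b k s - s * deriv (phi9 b k) s + (b ^ 2 - s ^ 2) * deriv (deriv (phi9 b k)) s)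
      = s * phi9 b k s + (b ^ 2 - s ^ 2) * deriv (phi9 b k) s := by
  have hbs : 0 < b ^ 2 - s ^ 2 := by nlinarith [hs.1, hs.2]
  rw [deriv_deriv_phi9 hbs hks, (hasDerivAt_phi9 hbs hks).deriv]
  simp only [phi9, one_mul, mul_one]
  have hA : √(1 - k * s ^ 2) ≠ 0 := (Real.sqrt_pos.2 hks).ne'
  have hB : √(b ^ 2 - s ^ 2) ≠ 0 := (Real.sqrt_pos.2 hbs).ne'
  have hA2 : 1 - k * s ^ 2 = √(1 - k * s ^ 2) ^ 2 := (Real.sq_sqrt hks.le).symm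
  have hB2 : b ^ 2 - s ^ 2 = √(b ^ 2 - s ^ 2) ^ 2 := (Real.sq_sqrt hbs.le).symm
  generalize √(1 - k * s ^ 2) = A at *
  generalize √(b ^ 2 - s ^ 2) = B at *
  generalize 2 * b / (1 - k * b ^ 2) = C
  have hP : A - s * (-(k * s) / A) + B ^ 2 * (-k / A ^ 3) = (A ^ 2 - k * B ^ 2) / A ^ 3 := by
    field_simp
    linear_combination (-A ^ 2) * hA2
  have hQ : B - s * (-s / B) + B ^ 2 * (-b ^ 2 / B ^ 3) = 0 := by
    field_simp
    linear_combination -hB2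
  have hR : s * A + B ^ 2 * (-(k * s) / A) = s * A ^ 2 * ((A ^ 2 - k * B ^ 2) / A ^ 3) := by
    field_simp
    ring
  have hS : s * B + B ^ 2 * (-s / B) = 0 := by
    field_simp
    ring
  rw [hA2, hB2]
  linear_combination C * b * s * A ^ 2 * hP - C * s * A ^ 2 * hQ - C * b * hR + C * hS
end
end

section
/- Let b > 0 and k be real constants with k·b² ≠ 1, and let s ∈ (0, b) satisfy 1 − k·s² > 0. Then the function φ(s) := (4b²/(1 − k·b²)²)·(b·√(1 − k·s²) − √(b² − s²))²/√(1 − k·s²) satisfies the identity s·(1 − k·s²)·(φ(s) − s·φ'(s) + (b² − s²)·φ''(s)) = 3·(s·φ(s) + (b² − s²)·φ'(s)). -/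
noncomputable section

open Real

/-- `φ(s) = (4b²/(1 − kb²)²)·(b√(1 − ks²) − √(b² − s²))²/√(1 − ks²)`. -/
def phi10 (b k : ℝ) (s : ℝ) : ℝ :=
  (4 * b ^ 2 / (1 - k * b ^ 2) ^ 2) *
    (b * Real.sqrt (1 - k * s ^ 2) - Real.sqrt (b ^ 2 - s ^ 2)) ^ 2
      / Real.sqrt (1 - k * s ^ 2)

/-- The set where both radicands in `phi10 b k` are positive is open. -/
theorem isOpen_phi10_radicands_pos (b k : ℝ) :
    IsOpen {x : ℝ | 0 < 1 - k * x ^ 2 ∧ 0 < b ^ 2 - x ^ 2} := by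
  refine (isOpen_lt ?_ ?_).and (isOpen_lt ?_ ?_) <;> fun_prop

theorem hasDerivAt_sqrt_const_sub_mul_sq {c k x : ℝ} (h : 0 < c - k * x ^ 2) :
    HasDerivAt (fun y => √(c - k * y ^ 2)) (-(k * x) / √(c - k * x ^ 2)) x := by
  have hd : HasDerivAt (fun y : ℝ => c - k * y ^ 2) (-(k * (2 * x))) x := by
    simpa using ((hasDerivAt_pow 2 x).const_mul k).const_sub c
  convert hd.sqrt h.ne' using 1
  have := (Real.sqrt_pos.2 h).ne'
  field_simp

theorem hasDerivAt_sqrt_const_sub_sq {c x : ℝ} (h : 0 < c - x ^ 2) :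
    HasDerivAt (fun y => √(c - y ^ 2)) (-x / √(c - x ^ 2)) x := by
  simpa using hasDerivAt_sqrt_const_sub_mul_sq (c := c) (k := 1) (x := x) (by simpa using h)

theorem phi10_eq {b k x : ℝ} (hA : 0 < 1 - k * x ^ 2) (hB : 0 < b ^ 2 - x ^ 2) :
    phi10 b k x = 4 * b ^ 2 / (1 - k * b ^ 2) ^ 2 *
      ((2 * b ^ 2 - (1 + k * b ^ 2) * x ^ 2) / √(1 - k * x ^ 2) - 2 * b * √(b ^ 2 - x ^ 2)) := by
  have hA' := (Real.sqrt_pos.2 hA).ne'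
  rw [phi10, mul_div_assoc]
  congr 1
  field_simp
  linear_combination b ^ 2 * Real.sq_sqrt hA.le + Real.sq_sqrt hB.le

theorem hasDerivAt_phi10 {b k x : ℝ} (hA : 0 < 1 - k * x ^ 2) (hB : 0 < b ^ 2 - x ^ 2) :
    HasDerivAt (phi10 b k) (4 * b ^ 2 / (1 - k * b ^ 2) ^ 2 *
      ((k * (1 + k * b ^ 2) * x ^ 3 - 2 * x) / √(1 - k * x ^ 2) ^ 3
        + 2 * b * (x / √(b ^ 2 - x ^ 2)))) x := by
  have hA' := (Real.sqrt_pos.2 hA).ne'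
  have hN : HasDerivAt (fun y : ℝ => 2 * b ^ 2 - (1 + k * b ^ 2) * y ^ 2)
      (-((1 + k * b ^ 2) * (2 * x))) x := by
    simpa using ((hasDerivAt_pow 2 x).const_mul (1 + k * b ^ 2)).const_sub (2 * b ^ 2)
  have h := ((hN.div (hasDerivAt_sqrt_const_sub_mul_sq hA) hA').sub
    ((hasDerivAt_sqrt_const_sub_sq hB).const_mul (2 * b))).const_mul
      (4 * b ^ 2 / (1 - k * b ^ 2) ^ 2)
  refine (h.congr_of_eventuallyEq ?_).congr_deriv ?_
  · filter_upwards [(isOpen_phi10_radicands_pos b k).mem_nhds ⟨hA, hB⟩] with y hy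
    exact phi10_eq hy.1 hy.2
  · have hq := Real.sq_sqrt hA.le
    congr 1
    rw [neg_div √(b ^ 2 - x ^ 2) x, mul_neg, sub_neg_eq_add]
    congr 1
    field_simp
    linear_combination (-2 * (1 + k * b ^ 2) * x) * hq

theorem hasDerivAt_deriv_phi10 {b k x : ℝ} (hA : 0 < 1 - k * x ^ 2) (hB : 0 < b ^ 2 - x ^ 2) :
    HasDerivAt (deriv (phi10 b k)) (4 * b ^ 2 / (1 - k * b ^ 2) ^ 2 *
      (((3 * k * (1 + k * b ^ 2) - 4 * k) * x ^ 2 - 2) / √(1 - k * x ^ 2) ^ 5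
        + 2 * b * (b ^ 2 / √(b ^ 2 - x ^ 2) ^ 3))) x := by
  have hA' := (Real.sqrt_pos.2 hA).ne'
  have hB' := (Real.sqrt_pos.2 hB).ne'
  have hN : HasDerivAt (fun y : ℝ => k * (1 + k * b ^ 2) * y ^ 3 - 2 * y)
      (k * (1 + k * b ^ 2) * (3 * x ^ 2) - 2) x := by
    simpa using ((hasDerivAt_pow 3 x).const_mul (k * (1 + k * b ^ 2))).fun_sub
      ((hasDerivAt_id x).const_mul 2)
  have h := ((hN.div ((hasDerivAt_sqrt_const_sub_mul_sq hA).pow 3) (pow_ne_zero 3 hA')).add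
    (((hasDerivAt_id x).div (hasDerivAt_sqrt_const_sub_sq hB) hB').const_mul (2 * b))).const_mul
      (4 * b ^ 2 / (1 - k * b ^ 2) ^ 2)
  refine (h.congr_of_eventuallyEq ?_).congr_deriv ?_
  · filter_upwards [(isOpen_phi10_radicands_pos b k).mem_nhds ⟨hA, hB⟩] with y hy
    exact (hasDerivAt_phi10 hy.1 hy.2).deriv
  · have hq := Real.sq_sqrt hA.le
    have hr := Real.sq_sqrt hB.le
    congr 1
    congr 1
    · simp only [Pi.pow_apply]
      field_simp
      push_cast
      linear_combination (k * (1 + k * b ^ 2) * (3 * x ^ 2) - 2) * √(1 - k * x ^ 2) ^ 2 * hq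
    · congr 1
      simp only [id]
      field_simp
      linear_combination hr

/-- `φ(s) = (4b²/(1−kb²)²)(b√(1−ks²) − √(b²−s²))²/√(1−ks²)`
satisfies the `m = 4` classifying ODE in cross-multiplied form. -/
theorem phi10_ode (b k s : ℝ) (hb : 0 < b) (hk : k * b ^ 2 ≠ 1)
    (hs : s ∈ Set.Ioo (0 : ℝ) b) (hks : 0 < 1 - k * s ^ 2) :
    s * (1 - k * s ^ 2) *
        (phi10 b k s - s * deriv (phi10 b k) s
          + (b ^ 2 - s ^ 2) * deriv (deriv (phi10 b k)) s)
      = 3 * (s * phi10 b k s + (b ^ 2 - s ^ 2) * deriv (phi10 b k) s) := by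
  have hB : 0 < b ^ 2 - s ^ 2 := by nlinarith [hs.1, hs.2]
  have hA' := (Real.sqrt_pos.2 hks).ne'
  have hB' := (Real.sqrt_pos.2 hB).ne'
  have hq := Real.sq_sqrt hks.le
  have hr := Real.sq_sqrt hB.le
  rw [(hasDerivAt_deriv_phi10 hks hB).deriv, (hasDerivAt_phi10 hks hB).deriv, phi10_eq hks hB]
  generalize 4 * b ^ 2 / (1 - k * b ^ 2) ^ 2 = C
  set A := √(1 - k * s ^ 2)
  set B := √(b ^ 2 - s ^ 2)
  have hP : s * A ^ 2 * ((2 * b ^ 2 - (1 + k * b ^ 2) * s ^ 2) / A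
      - s * ((k * (1 + k * b ^ 2) * s ^ 3 - 2 * s) / A ^ 3)
      + (b ^ 2 - s ^ 2) * (((3 * k * (1 + k * b ^ 2) - 4 * k) * s ^ 2 - 2) / A ^ 5))
      = 3 * (s * ((2 * b ^ 2 - (1 + k * b ^ 2) * s ^ 2) / A)
        + (b ^ 2 - s ^ 2) * ((k * (1 + k * b ^ 2) * s ^ 3 - 2 * s) / A ^ 3)) := by
    field_simp
    rw [hq]
    ring
  have hQ : B - s * (-s / B) + B ^ 2 * (-b ^ 2 / B ^ 3) = 0 := by
    field_simp
    linear_combination hr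
  have hQ' : s * B + B ^ 2 * (-s / B) = 0 := by
    field_simp
    ring
  rw [hq] at hP
  rw [hr] at hQ hQ'
  linear_combination C * hP - 2 * b * C * (s * (1 - k * s ^ 2) * hQ - 3 * hQ')
end
end

section
/- Let b > 0 and k be real constants with k·b² ≠ 1, and let s ∈ (0, b) be such that 1 − k·t² > 0 for all t ∈ [0, s]. Then ∫₀ˢ t/((b² − t²)^{3/2}·√(1 − k·t²)) dt = (1/(1 − k·b²))·(√(1 − k·s²)/√(b² − s²) − 1/b). -/
noncomputable section

open Real

theorem rpow_three_halves_eq_sqrt_pow {x : ℝ} (hx : 0 ≤ x) :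
    x ^ ((3 : ℝ) / 2) = √x ^ 3 := by
  rw [Real.sqrt_eq_rpow, ← Real.rpow_natCast, ← Real.rpow_mul hx]
  norm_num

theorem hasDerivAt_sqrt_div_sqrt {b k t : ℝ} (hb : 0 < b ^ 2 - t ^ 2)
    (hk : 0 < 1 - k * t ^ 2) :
    HasDerivAt (fun u => √(1 - k * u ^ 2) / √(b ^ 2 - u ^ 2))
      ((1 - k * b ^ 2) * (t / ((b ^ 2 - t ^ 2) ^ ((3 : ℝ) / 2) * √(1 - k * t ^ 2)))) t := by
  have hP := ((((hasDerivAt_id t).pow 2).const_mul k).const_sub 1).sqrt hk.ne'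
  have hQ := (((hasDerivAt_id t).pow 2).const_sub (b ^ 2)).sqrt hb.ne'
  have hP0 : 0 < √(1 - k * t ^ 2) := Real.sqrt_pos.2 hk
  have hQ0 : 0 < √(b ^ 2 - t ^ 2) := Real.sqrt_pos.2 hb
  have hP2 := Real.sq_sqrt hk.le
  have hQ2 := Real.sq_sqrt hb.le
  refine (hP.fun_div hQ hQ0.ne').congr_deriv ?_
  rw [rpow_three_halves_eq_sqrt_pow hb.le]
  simp only [id, Pi.pow_apply]
  generalize √(1 - k * t ^ 2) = P at *
  generalize √(b ^ 2 - t ^ 2) = Q at *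
  field_simp
  push_cast
  linear_combination (2 * t) * hP2 - (2 * t * k) * hQ2

/-- `∫₀ˢ t/((b² − t²)^{3/2}√(1 − kt²)) dt
= (1/(1 − kb²))·(√(1 − ks²)/√(b² − s²) − 1/b)`. -/
theorem integral_m_two (b k s : ℝ) (hb : 0 < b) (hk : k * b ^ 2 ≠ 1)
    (hs : s ∈ Set.Ioo (0 : ℝ) b)
    (hpos : ∀ t ∈ Set.Icc (0 : ℝ) s, 0 < 1 - k * t ^ 2) :
    (∫ t in (0 : ℝ)..s,
        t / ((b ^ 2 - t ^ 2) ^ ((3 : ℝ) / 2) * Real.sqrt (1 - k * t ^ 2)))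
      = (1 / (1 - k * b ^ 2)) *
          (Real.sqrt (1 - k * s ^ 2) / Real.sqrt (b ^ 2 - s ^ 2) - 1 / b) := by
  have hbt : ∀ t ∈ Set.Icc (0 : ℝ) s, 0 < b ^ 2 - t ^ 2 := fun t ht => by
    nlinarith [ht.1, ht.2, hs.2]
  have hk' : 1 - k * b ^ 2 ≠ 0 := sub_ne_zero.2 hk.symm
  have hcont : ContinuousOn
      (fun t : ℝ => (1 - k * b ^ 2) *
        (t / ((b ^ 2 - t ^ 2) ^ ((3 : ℝ) / 2) * √(1 - k * t ^ 2)))) (Set.uIcc 0 s) := by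
    rw [Set.uIcc_of_le hs.1.le]
    refine continuousOn_const.mul (continuousOn_id.div (ContinuousOn.mul ?_ ?_) fun t ht => ?_)
    · exact ContinuousOn.rpow_const (by fun_prop) fun t ht => Or.inl (hbt t ht).ne'
    · fun_prop
    · exact (mul_pos (Real.rpow_pos_of_pos (hbt t ht) _) (Real.sqrt_pos.2 (hpos t ht))).ne'
  have hint := intervalIntegral.integral_eq_sub_of_hasDerivAt (a := 0) (b := s)
    (fun t ht => by
      rw [Set.uIcc_of_le hs.1.le] at ht
      exact hasDerivAt_sqrt_div_sqrt (hbt t ht) (hpos t ht)) hcont.intervalIntegrable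
  rw [intervalIntegral.integral_const_mul] at hint
  rw [one_div_mul_eq_div, eq_div_iff hk', mul_comm, hint]
  simp [Real.sqrt_sq hb.le]
end
end

section
/- Let m > 1, b > 0, k be real constants and 0 < ε < b. Suppose ψ : (−ε, ε) → ℝ is smooth with ψ(0) = 1 and ψ'(0) = 0, and suppose that φ(s) := s^m·ψ(s) (real power s^m) satisfies s·(1 − k·s²)·(φ(s) − s·φ'(s) + (b² − s²)·φ''(s)) = (m − 1)·(s·φ(s) + (b² − s²)·φ'(s)) for all s ∈ (0, ε). Then ψ''(0) = (m − 1)·(m·k·b² + 2)/((m + 2)·b²). -/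
noncomputable section

open Real

open Set Filter Topology

/-- Derivative of `s ↦ s ^ m * f s` at a positive point. -/
theorem hasDerivAt_rpow_mul {f : ℝ → ℝ} {f' s : ℝ} (m : ℝ) (hs : 0 < s)
    (hf : HasDerivAt f f' s) :
    HasDerivAt (fun x => x ^ m * f x) (s ^ m * (m * f s / s + f')) s := by
  refine ((Real.hasDerivAt_rpow_const (Or.inl hs.ne')).mul hf).congr_deriv ?_
  rw [Real.rpow_sub_one hs.ne']
  ring

/-- Second derivative of `s ↦ s ^ m * f s` on the positive axis, from the first one. -/
theorem hasDerivAt_rpow_mul_deriv {f f₁ : ℝ → ℝ} {f₂ s : ℝ} (m : ℝ) (hs : 0 < s)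
    (hf : HasDerivAt f (f₁ s) s) (hf₁ : HasDerivAt f₁ f₂ s) :
    HasDerivAt (fun x => x ^ m * (m * f x / x + f₁ x))
      (s ^ m * (m * (m - 1) * f s / s ^ 2 + 2 * m * f₁ s / s + f₂)) s := by
  have hs' := hs.ne'
  refine (hasDerivAt_rpow_mul m hs
    (((hf.const_mul m).div (hasDerivAt_id s) hs').add hf₁)).congr_deriv ?_
  simp only [id, Pi.add_apply, Pi.div_apply]
  field_simp
  ring

/-- if `φ(s) = sᵐ·ψ(s)` with `ψ` smooth near `0`, `ψ(0) = 1`,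
`ψ'(0) = 0`, satisfies the classifying ODE on `(0, ε)`, then
`ψ''(0) = (m − 1)(mkb² + 2)/((m + 2)b²)`, i.e. the Taylor coefficient
`a_{m+2} = ψ''(0)/2 = (m − 1)(mkb² + 2)/(2(m + 2)b²)`. -/
theorem taylor_coeff_a_m_plus_two (m b k ε : ℝ) (hm : 1 < m) (hb : 0 < b)
    (hε : 0 < ε) (hεb : ε < b)
    (ψ : ℝ → ℝ) (hψ : ContDiffOn ℝ (⊤ : ℕ∞) ψ (Set.Ioo (-ε) ε))
    (hψ0 : ψ 0 = 1) (hψ'0 : deriv ψ 0 = 0)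
    (φ : ℝ → ℝ) (hφ : ∀ s ∈ Set.Ioo (0 : ℝ) ε, φ s = s ^ m * ψ s)
    (hODE : ∀ s ∈ Set.Ioo (0 : ℝ) ε,
      s * (1 - k * s ^ 2) *
          (φ s - s * deriv φ s + (b ^ 2 - s ^ 2) * deriv (deriv φ) s)
        = (m - 1) * (s * φ s + (b ^ 2 - s ^ 2) * deriv φ s)) :
    deriv (deriv ψ) 0 = (m - 1) * (m * k * b ^ 2 + 2) / ((m + 2) * b ^ 2) := by
  have hU : IsOpen (Ioo (-ε) ε) := isOpen_Ioo
  have h0 : (0 : ℝ) ∈ Ioo (-ε) ε := ⟨by linarith, hε⟩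
  have hψ₁ : ContDiffOn ℝ (⊤ : ℕ∞) (deriv ψ) (Ioo (-ε) ε) :=
    hψ.deriv_of_isOpen hU (by simp)
  have hψ₂ : ContDiffOn ℝ (⊤ : ℕ∞) (deriv (deriv ψ)) (Ioo (-ε) ε) :=
    hψ₁.deriv_of_isOpen hU (by simp)
  have hd : ∀ s ∈ Ioo (-ε) ε, HasDerivAt ψ (deriv ψ s) s := fun s hs =>
    ((hψ.differentiableOn (by simp)).differentiableAt (hU.mem_nhds hs)).hasDerivAt
  have hd₁ : ∀ s ∈ Ioo (-ε) ε, HasDerivAt (deriv ψ) (deriv (deriv ψ) s) s := fun s hs =>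
    ((hψ₁.differentiableOn (by simp)).differentiableAt (hU.mem_nhds hs)).hasDerivAt
  have hsub : ∀ s ∈ Ioo 0 ε, s ∈ Ioo (-ε) ε := fun s hs => ⟨by linarith [hs.1], hs.2⟩
  have hφ₁ : ∀ s ∈ Ioo 0 ε, deriv φ s = s ^ m * (m * ψ s / s + deriv ψ s) := fun s hs =>
    ((hasDerivAt_rpow_mul m hs.1 (hd s (hsub s hs))).congr_of_eventuallyEq
      (eventually_of_mem (isOpen_Ioo.mem_nhds hs) hφ)).deriv
  have hφ₂ : ∀ s ∈ Ioo 0 ε, deriv (deriv φ) s =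
      s ^ m * (m * (m - 1) * ψ s / s ^ 2 + 2 * m * deriv ψ s / s + deriv (deriv ψ) s) :=
    fun s hs => ((hasDerivAt_rpow_mul_deriv m hs.1 (hd s (hsub s hs))
      (hd₁ s (hsub s hs))).congr_of_eventuallyEq
      (eventually_of_mem (isOpen_Ioo.mem_nhds hs) hφ₁)).deriv
  -- the equation divided by `s ^ (m + 1)`, in which the singular terms cancel
  have hreg : ∀ s ∈ Ioo 0 ε,
      (1 - k * s ^ 2) * ((1 - m) * ψ s - s * deriv ψ s +
          (b ^ 2 - s ^ 2) * (2 * m * (deriv ψ s / s) + deriv (deriv ψ) s)) -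
          k * (b ^ 2 - s ^ 2) * (m * (m - 1)) * ψ s -
        (m - 1) * (ψ s + (b ^ 2 - s ^ 2) * (deriv ψ s / s)) = 0 := by
    intro s hs
    have h := hODE s hs
    rw [hφ s hs, hφ₁ s hs, hφ₂ s hs] at h
    have hs0 : s ≠ 0 := hs.1.ne'
    have hp : s ^ m ≠ 0 := (Real.rpow_pos_of_pos hs.1 m).ne'
    refine (mul_eq_zero.mp ?_).resolve_left (mul_ne_zero hs0 hp)
    rw [← sub_eq_zero] at h
    rw [← h]
    field_simp
    ring
  have hle : 𝓝[>] (0 : ℝ) ≤ 𝓝 0 := nhdsWithin_le_nhds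
  have tψ : Tendsto ψ (𝓝[>] 0) (𝓝 1) := by
    simpa [hψ0] using (hd 0 h0).continuousAt.tendsto.mono_left hle
  have tψ₁ : Tendsto (deriv ψ) (𝓝[>] 0) (𝓝 0) := by
    simpa [hψ'0] using (hd₁ 0 h0).continuousAt.tendsto.mono_left hle
  have tψ₂ : Tendsto (deriv (deriv ψ)) (𝓝[>] 0) (𝓝 (deriv (deriv ψ) 0)) :=
    (hψ₂.continuousOn.continuousAt (hU.mem_nhds h0)).tendsto.mono_left hle
  have tq : Tendsto (fun s => deriv ψ s / s) (𝓝[>] 0) (𝓝 (deriv (deriv ψ) 0)) := by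
    have h := (hasDerivAt_iff_tendsto_slope.mp (hd₁ 0 h0)).mono_left
      (nhdsWithin_mono 0 fun x (hx : 0 < x) => hx.ne')
    refine h.congr fun s => ?_
    simp [slope_def_field, hψ'0]
  have ts : Tendsto (fun s : ℝ => s) (𝓝[>] 0) (𝓝 0) := hle
  have tb := (ts.pow 2).const_sub (b ^ 2)
  have hlim := (((((ts.pow 2).const_mul k).const_sub 1).mul
    (((tψ.const_mul (1 - m)).sub (ts.mul tψ₁)).add
      (tb.mul ((tq.const_mul (2 * m)).add tψ₂)))).sub
    (((tb.const_mul k).mul_const (m * (m - 1))).mul tψ)).sub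
    ((tψ.add (tb.mul tq)).const_mul (m - 1))
  have hkey := tendsto_nhds_unique_of_eventuallyEq hlim tendsto_const_nhds
    (eventually_of_mem (Ioo_mem_nhdsGT hε) hreg)
  rw [eq_div_iff (by positivity)]
  linear_combination hkey
end
end

section
/- Let q : ℝ² → ℝ be a positive definite quadratic form, let ℓ, σ : ℝ² → ℝ be linear forms with ℓ ≠ 0, and let b > 0, τ, k₂ be real constants with 1 + k₂·b² ≠ 0. If b²·σ(y)·q(y) + (8·b²·τ·(1 + k₂·b²)·ℓ(y) − (2 + k₂·b²)·σ(y))·ℓ(y)² = 0 for all y ∈ ℝ², then σ = 0 and τ = 0. -/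
noncomputable section

/-- if `q` is a positive definite quadratic form on `ℝ²`,
`ℓ ≠ 0` and `σ` are linear forms, `b > 0`, `1 + k₂b² ≠ 0`, and
`b²·σ(y)·q(y) + (8b²τ(1 + k₂b²)ℓ(y) − (2 + k₂b²)σ(y))·ℓ(y)² = 0` for all `y`,
then `σ = 0` and `τ = 0`. -/
theorem vanishing_T_argument (q : QuadraticForm ℝ (Fin 2 → ℝ))
    (hq : ∀ y : Fin 2 → ℝ, y ≠ 0 → 0 < q y)
    (ℓ σ : (Fin 2 → ℝ) →ₗ[ℝ] ℝ) (hℓ : ℓ ≠ 0)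
    (b τ k₂ : ℝ) (hb : 0 < b) (hk : 1 + k₂ * b ^ 2 ≠ 0)
    (heq : ∀ y : Fin 2 → ℝ,
      b ^ 2 * σ y * q y
        + (8 * b ^ 2 * τ * (1 + k₂ * b ^ 2) * ℓ y - (2 + k₂ * b ^ 2) * σ y) * (ℓ y) ^ 2
        = 0) :
    σ = 0 ∧ τ = 0 := by
  have hb2 : b ^ 2 ≠ 0 := pow_ne_zero 2 hb.ne'
  obtain ⟨u, hu⟩ : ∃ u, ℓ u ≠ 0 := by
    by_contra! h
    exact hℓ (LinearMap.ext h)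
  obtain ⟨w, hw⟩ : ∃ w, ℓ w = 1 := ⟨(ℓ u)⁻¹ • u, by simp [hu]⟩
  have hker : ∀ y, ℓ y = 0 → σ y = 0 := by
    intro y hy
    by_cases hy0 : y = 0
    · simp [hy0]
    · have h := heq y
      simpa [hy, hb.ne', (hq y hy0).ne'] using h
  have hσ_eq : ∀ y, σ y = ℓ y * σ w := by
    intro y
    have h := hker (y - ℓ y • w) (by simp [hw])
    simpa [sub_eq_zero] using h
  obtain ⟨v, hv, hv0⟩ : ∃ v ∈ LinearMap.ker ℓ, v ≠ 0 :=
    Submodule.exists_mem_ne_zero_of_ne_bot (LinearMap.ker_ne_bot_of_finrank_lt (by simp))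
  rw [LinearMap.mem_ker] at hv
  have hσv : σ v = 0 := hker v hv
  have hσw : σ w = 0 := by
    have h0 := heq w
    have h1 := heq (w + v)
    have h2 := heq (w + -v)
    simp only [map_add, map_neg, hv, hσv, hw, QuadraticMap.map_add q w,
      QuadraticMap.map_neg, QuadraticMap.polar_neg_right] at h0 h1 h2
    have h : b ^ 2 * q v * σ w = 0 := by linear_combination (h1 + h2) / 2 - h0
    exact (mul_eq_zero.mp h).resolve_left (mul_ne_zero hb2 (hq v hv0).ne')
  refine ⟨LinearMap.ext fun y => by simp [hσ_eq y, hσw], ?_⟩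
  have h := heq w
  simpa [hσw, hw, hb.ne', hk] using h
end
end
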